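/- arXiv:2001.11763 — 3 statements merged into one kernel-verified Lean document; each statement's English description precedes it below -/
import Mathlib

section
/- Let n be a nonnegative integer. There exists an extremal square-free circular word of length n over the three-letter alphabet Γ = {a, b, c} if and only if n belongs to the set B = {4, 6, 8, 13, 15, 16, 18, 20, 21, 22, 23, 24, 28, 30, 32, 33, 34, 35, 36} ∪ {m : m ≥ 38}. -/
/-- A word `w` is square-free if it contains no factor `x ++ x` with `x` nonempty. -/
def SquareFree {α : Type*} (w : List α) : Prop :=
  ∀ x : List α, x ≠ [] → ¬ (x ++ x) <:+: w

/-- `v` is an extension of `w`: insert a single letter anywhere in `w`. -/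
def IsExtension {α : Type*} (w v : List α) : Prop :=
  ∃ (w' w'' : List α) (a : α), w = w' ++ w'' ∧ v = w' ++ [a] ++ w''

/-- `w` is extremal square-free. -/
def ExtremalSquareFree {α : Type*} (w : List α) : Prop :=
  SquareFree w ∧ ∀ v, IsExtension w v → ¬ SquareFree v

/-- The circular word `⟨w⟩` is square-free: every conjugate (rotation) of `w` is square-free. -/
def CircSquareFree {α : Type*} (w : List α) : Prop :=
  ∀ u : List α, u ~r w → SquareFree u

/-- The circular word `⟨w⟩` is extremal square-free. -/
def ExtremalCircSquareFree {α : Type*} (w : List α) : Prop :=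
  CircSquareFree w ∧
    ∀ (w' w'' : List α) (a : α), w = w' ++ w'' → ¬ CircSquareFree (w' ++ [a] ++ w'')

/-! ### Square-free words by positions -/

section Positions

variable {α : Type*}

theorem SquareFree.of_infix {u w : List α} (hw : SquareFree w) (h : u <:+: w) : SquareFree u :=
  fun x hx hxu => hw x hx (hxu.trans h)

theorem CircSquareFree.squareFree {w : List α} (h : CircSquareFree w) : SquareFree w :=
  h w (List.IsRotated.refl w)

theorem CircSquareFree.of_isRotated {u w : List α} (hw : CircSquareFree w) (h : u ~r w) :
    CircSquareFree u :=
  fun v hv => hw v (hv.trans h)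

theorem SquareFree.of_map {β : Type*} (f : α → β) {w : List α} (h : SquareFree (w.map f)) :
    SquareFree w := by
  rintro x hx ⟨s, t, hst⟩
  refine h (x.map f) (by simpa using hx) ⟨s.map f, t.map f, ?_⟩
  simp [← hst]

theorem CircSquareFree.of_map {β : Type*} (f : α → β) {w : List α}
    (h : CircSquareFree (w.map f)) : CircSquareFree w :=
  fun _ hu => SquareFree.of_map f (h _ (hu.map f))

theorem getElem?_append_length_add (u v : List α) (k : ℕ) : (u ++ v)[u.length + k]? = v[k]? := by
  rw [List.getElem?_append_right (by omega), Nat.add_sub_cancel_left]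

/-- Square-freeness in terms of the letters at given positions. -/
theorem squareFree_iff {w : List α} :
    SquareFree w ↔ ∀ q l, 0 < l → q + 2 * l ≤ w.length → ∃ j < l, w[q + j]? ≠ w[q + l + j]? := by
  constructor
  · intro h q l hl hq
    by_contra! hcon
    have hx : (w.drop (q + l)).take l = (w.drop q).take l := by
      apply List.ext_getElem?
      intro j
      by_cases hj : j < l
      · simp [hj, hcon j hj]
      · simp [hj]
    refine h ((w.drop q).take l) ?_ ⟨w.take q, w.drop (q + 2 * l), ?_⟩
    · intro h0
      have := congrArg List.length h0
      simp at this
      omega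
    · conv_lhs => rw [List.append_assoc, List.append_assoc]
      nth_rewrite 2 [← hx]
      rw [show q + 2 * l = q + l + l by ring, ← List.drop_drop (i := l) (j := q + l),
        List.take_append_drop, ← List.drop_drop, List.take_append_drop, List.take_append_drop]
  · rintro h x hx ⟨s, t, rfl⟩
    obtain ⟨j, hj, hne⟩ := h s.length x.length (List.length_pos_iff.2 hx) (by simp; omega)
    apply hne
    rw [List.append_assoc, List.append_assoc, add_assoc, getElem?_append_length_add,
      getElem?_append_length_add, getElem?_append_length_add, List.getElem?_append_left hj,
      List.getElem?_append_left hj]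

/-- The letter of the circular word `⟨w⟩` at position `i`, read cyclically. -/
def cyc (w : List α) (i : ℕ) : Option α := w[i % w.length]?

theorem cyc_add_length (w : List α) (i : ℕ) : cyc w (i + w.length) = cyc w i := by
  simp [cyc]

theorem getElem?_append_self {w : List α} {i : ℕ} (hi : i < 2 * w.length) :
    (w ++ w)[i]? = cyc w i := by
  unfold cyc
  by_cases h : i < w.length
  · rw [List.getElem?_append_left h, Nat.mod_eq_of_lt h]
  · rw [List.getElem?_append_right (by omega), Nat.mod_eq_sub_mod (by omega),
      Nat.mod_eq_of_lt (by omega)]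

theorem getElem?_rotate {w : List α} {i : ℕ} (hi : i < w.length) (q : ℕ) :
    (w.rotate q)[i]? = cyc w (q + i) := by
  rw [List.getElem?_rotate hi, cyc, Nat.add_comm]

theorem circSquareFree_iff {w : List α} :
    CircSquareFree w ↔
      ∀ q l, 0 < l → 2 * l ≤ w.length → ∃ j < l, cyc w (q + j) ≠ cyc w (q + l + j) := by
  constructor
  · intro h q l hl hlw
    obtain ⟨j, hj, hne⟩ := squareFree_iff.1 (h (w.rotate q) (List.IsRotated.symm ⟨q, rfl⟩)) 0 l hl
      (by simpa using hlw)
    refine ⟨j, hj, ?_⟩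
    rwa [getElem?_rotate (by omega), getElem?_rotate (by omega), zero_add, ← add_assoc,
      zero_add] at hne
  · rintro h u hu
    obtain ⟨r, rfl⟩ := hu.symm
    rw [squareFree_iff]
    intro q l hl hq
    rw [List.length_rotate] at hq
    obtain ⟨j, hj, hne⟩ := h (r + q) l hl (by omega)
    refine ⟨j, hj, ?_⟩
    rwa [getElem?_rotate (by omega), getElem?_rotate (by omega), ← add_assoc, ← add_assoc,
      ← add_assoc]

theorem circSquareFree_iff_append_self {w : List α} :
    CircSquareFree w ↔ ∀ l, 0 < l → 2 * l ≤ w.length →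
      ∀ q < w.length, ∃ j < l, (w ++ w)[q + j]? ≠ (w ++ w)[q + l + j]? := by
  rw [circSquareFree_iff]
  constructor
  · intro h l hl hlw q hq
    obtain ⟨j, hj, hne⟩ := h q l hl hlw
    refine ⟨j, hj, ?_⟩
    rwa [getElem?_append_self (by omega), getElem?_append_self (by omega)]
  · intro h q l hl hlw
    have hpos : 0 < w.length := by omega
    obtain ⟨j, hj, hne⟩ := h l hl hlw (q % w.length) (Nat.mod_lt _ hpos)
    refine ⟨j, hj, ?_⟩
    have hq := Nat.mod_lt q hpos
    rw [getElem?_append_self (by omega), getElem?_append_self (by omega)] at hne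
    simpa [cyc, add_assoc] using hne

/-- Extremality in terms of letters put in front of the conjugates. -/
theorem extremalCircSquareFree_iff {w : List α} :
    ExtremalCircSquareFree w ↔
      CircSquareFree w ∧ ∀ y, y ~r w → ∀ a, ¬ CircSquareFree (a :: y) := by
  have key : ∀ (w' w'' : List α) (a : α), w' ++ [a] ++ w'' ~r a :: (w'' ++ w') := by
    intro w' w'' a
    simpa using List.isRotated_append (l := w') (l' := [a] ++ w'')
  unfold ExtremalCircSquareFree
  refine and_congr_right fun _ => ⟨fun h y hy a hc => ?_, fun h w' w'' a e hc => ?_⟩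
  · obtain ⟨n, hn, rfl⟩ := List.isRotated_iff_mod.1 hy.symm
    rw [List.rotate_eq_drop_append_take hn] at hc
    exact h _ _ a (List.take_append_drop n w).symm (hc.of_isRotated (key _ _ a))
  · subst e
    exact h (w'' ++ w') List.isRotated_append a (hc.of_isRotated (key w' w'' a).symm)

theorem ExtremalCircSquareFree.of_isRotated {u w : List α} (hw : ExtremalCircSquareFree w)
    (h : u ~r w) : ExtremalCircSquareFree u := by
  rw [extremalCircSquareFree_iff] at hw ⊢
  exact ⟨hw.1.of_isRotated h, fun y hy => hw.2 y (hy.trans h)⟩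

theorem ExtremalCircSquareFree.map_equiv {β : Type*} {w : List α}
    (hw : ExtremalCircSquareFree w) (e : α ≃ β) : ExtremalCircSquareFree (w.map e) := by
  rw [extremalCircSquareFree_iff] at hw ⊢
  have key : ∀ {v : List α}, CircSquareFree v → CircSquareFree (v.map e) := fun {v} hv =>
    CircSquareFree.of_map e.symm (by simpa using hv)
  refine ⟨key hw.1, fun y hy a hc => ?_⟩
  refine hw.2 (y.map e.symm) (by simpa using hy.map e.symm) (e.symm a) ?_
  exact CircSquareFree.of_map e (by simpa using hc)

end Positions

/-! ### Words as numbers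

Ternary words are encoded as numbers in base `4` with digits `1`, `2`, `3`, and squares are looked
for by bitwise operations on these numbers. The recursors are written out so that the tests reduce
fast in the kernel. -/

/-- `force f n` is `f n`, but reduction evaluates `n` to a literal first. -/
def force {α : Type} (f : ℕ → α) (n : ℕ) : α :=
  Nat.rec (motive := fun _ => α) (f 0) (fun k _ => f k) (Nat.add n 1)

theorem force_eq {α : Type} (f : ℕ → α) (n : ℕ) : force f n = f n := rfl

/-- `p` holds at the `fuel` consecutive numbers starting with the given one. -/
noncomputable def allFrom (p : ℕ → Bool) (fuel : ℕ) : ℕ → Bool :=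
  Nat.rec (motive := fun _ => ℕ → Bool) (fun _ => true)
    (fun _ ih i => Bool.rec false (force ih (Nat.add i 1)) (p i)) fuel

theorem allFrom_iff {p : ℕ → Bool} {fuel i : ℕ} :
    allFrom p fuel i = true ↔ ∀ k, i ≤ k → k < i + fuel → p k = true := by
  induction fuel generalizing i with
  | zero => exact ⟨fun _ k _ _ => by omega, fun _ => rfl⟩
  | succ f ih =>
    have step : allFrom p (f + 1) i = (p i && allFrom p f (i + 1)) := by
      change Bool.rec (motive := fun _ => Bool) false (allFrom p f (i + 1)) (p i) = _
      cases p i <;> rfl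
    rw [step, Bool.and_eq_true, ih]
    constructor
    · rintro ⟨h0, h1⟩ k hk hk'
      rcases hk.eq_or_lt with rfl | hlt
      · exact h0
      · exact h1 k hlt (by omega)
    · exact fun h => ⟨h i le_rfl (by omega), fun k hk hk' => h k (by omega) (by omega)⟩

/-- The encoding of a ternary word as a number. -/
def enc : List (Fin 3) → ℕ
  | [] => 0
  | a :: w => (a + 1) + 4 * enc w

theorem enc_append (u v : List (Fin 3)) : enc (u ++ v) = enc u + 4 ^ u.length * enc v := by
  induction u with
  | nil => simp [enc]
  | cons a u ih => simp only [List.cons_append, enc, ih, List.length_cons, pow_succ]; ring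

theorem enc_lt (u : List (Fin 3)) : enc u < 4 ^ u.length := by
  induction u with
  | nil => simp [enc]
  | cons a u ih => simp only [enc, List.length_cons, pow_succ]; omega

theorem enc_injective : Function.Injective enc := by
  intro u v
  induction u generalizing v with
  | nil => cases v with
    | nil => simp
    | cons b v => simp only [enc]; omega
  | cons a u ih => cases v with
    | nil => simp only [enc]; omega
    | cons b v =>
      simp only [enc]
      intro h
      rw [ih (show enc u = enc v by omega), show a = b from Fin.ext (by omega)]

theorem enc_drop (w : List (Fin 3)) (i : ℕ) : enc (w.drop i) = enc w / 4 ^ i := by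
  induction i generalizing w with
  | zero => simp
  | succ i ih => cases w with
    | nil => simp [enc]
    | cons a w =>
      rw [List.drop_succ_cons, ih, pow_succ', ← Nat.div_div_eq_div_mul]
      simp only [enc]
      congr 1
      omega

theorem enc_take (w : List (Fin 3)) (i : ℕ) : enc (w.take i) = enc w % 4 ^ i := by
  rcases le_total i w.length with h | h
  · conv_rhs => rw [← List.take_append_drop i w, enc_append]
    have := enc_lt (w.take i)
    rw [List.length_take_of_le h] at this ⊢
    rw [Nat.add_mul_mod_self_left, Nat.mod_eq_of_lt this]
  · rw [List.take_of_length_le h, Nat.mod_eq_of_lt]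
    exact (enc_lt w).trans_le (Nat.pow_le_pow_right (by norm_num) h)

theorem enc_testBit (w : List (Fin 3)) (i : ℕ) :
    (enc w).testBit (2 * i) = w[i]?.elim false (fun a => (a.val + 1).testBit 0) ∧
      (enc w).testBit (2 * i + 1) = w[i]?.elim false (fun a => (a.val + 1).testBit 1) := by
  induction w generalizing i with
  | nil => simp [enc]
  | cons a w ih =>
    have e : enc (a :: w) = 2 ^ 2 * enc w + (a.val + 1) := by simp only [enc]; ring
    have ha : a.val + 1 < 2 ^ 2 := by omega
    rw [e]
    constructor
    all_goals rw [Nat.testBit_two_pow_mul_add _ ha]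
    all_goals cases i with
      | zero => simp
      | succ i => ?_
    · rw [if_neg (by omega), show 2 * (i + 1) - 2 = 2 * i by omega, (ih i).1]; simp
    · rw [if_neg (by omega), show 2 * (i + 1) + 1 - 2 = 2 * i + 1 by omega, (ih i).2]; simp

theorem getElem?_eq_iff_testBit (w : List (Fin 3)) (i j : ℕ) :
    w[i]? = w[j]? ↔ (enc w).testBit (2 * i) = (enc w).testBit (2 * j) ∧
      (enc w).testBit (2 * i + 1) = (enc w).testBit (2 * j + 1) := by
  rw [(enc_testBit w i).1, (enc_testBit w i).2, (enc_testBit w j).1, (enc_testBit w j).2]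
  generalize w[i]? = x
  generalize w[j]? = y
  revert x y
  decide

/-- The number with `c` digits `1` in base `4`. -/
def repOne (c : ℕ) : ℕ := Nat.div (Nat.sub (Nat.pow 4 c) 1) 3

theorem repOne_succ (c : ℕ) : repOne (c + 1) = 2 ^ 2 * repOne c + 1 := by
  have h : ∀ c, 3 * repOne c + 1 = 4 ^ c := by
    intro c
    have h3 : 4 ^ c % 3 = 1 := by rw [Nat.pow_mod]; simp
    change 3 * ((4 ^ c - 1) / 3) + 1 = 4 ^ c
    generalize 4 ^ c = P at h3 ⊢
    omega
  have h1 := h (c + 1)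
  have h2 := h c
  rw [pow_succ] at h1
  omega

theorem repOne_testBit (c i : ℕ) : (repOne c).testBit i = true ↔ i < 2 * c ∧ i % 2 = 0 := by
  induction c generalizing i with
  | zero => simp [show repOne 0 = 0 from rfl]
  | succ c ih =>
    rw [repOne_succ, Nat.testBit_two_pow_mul_add _ (by norm_num)]
    split_ifs with h
    · interval_cases i
      · simp
      · simp [Nat.testBit]
    · rw [ih]; omega

/-- Given the disjunction `R` of `c` consecutive shifts of a number, test whether the disjunction
of `k` consecutive shifts contains the bits of `E`. -/
noncomputable def orCovers (E k fuel : ℕ) : ℕ → ℕ → Bool :=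
  Nat.rec (motive := fun _ => ℕ → ℕ → Bool)
    (fun c R => Nat.beq (Nat.land (Nat.lor R (Nat.shiftRight R (Nat.sub k c))) E) E)
    (fun _ ih c R => Bool.rec
      (Nat.beq (Nat.land (Nat.lor R (Nat.shiftRight R (Nat.sub k c))) E) E)
      (force (fun c' => force (ih c') (Nat.lor R (Nat.shiftRight R c))) (Nat.mul 2 c))
      (Nat.ble (Nat.mul 2 c) k)) fuel

theorem land_eq_right_iff {A E : ℕ} :
    Nat.beq (Nat.land A E) E = true ↔ ∀ i, E.testBit i = true → A.testBit i = true := by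
  have h0 : Nat.beq (Nat.land A E) E = true ↔ A &&& E = E :=
    ⟨Nat.eq_of_beq_eq_true, fun h => by rw [show Nat.land A E = E from h]; exact Nat.beq_refl E⟩
  rw [h0]
  constructor
  · intro h i hi
    rw [← h, Nat.testBit_land, Bool.and_eq_true] at hi
    exact hi.1
  · intro h
    apply Nat.eq_of_testBit_eq
    intro i
    rw [Nat.testBit_land]
    cases hE : E.testBit i
    · simp
    · simp [h i hE]

theorem lor_shiftRight_testBit {X R c s : ℕ} (hs : s ≤ c)
    (hR : ∀ i, R.testBit i = true ↔ ∃ t < c, X.testBit (i + t) = true) (i : ℕ) :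
    (R ||| R >>> s).testBit i = true ↔ ∃ t < c + s, X.testBit (i + t) = true := by
  rw [Nat.testBit_lor, Bool.or_eq_true, Nat.testBit_shiftRight, hR, hR]
  constructor
  · rintro (⟨t, ht, h⟩ | ⟨t, ht, h⟩)
    · exact ⟨t, by omega, h⟩
    · exact ⟨s + t, by omega, by rwa [show i + (s + t) = s + i + t by ring]⟩
  · rintro ⟨t, ht, h⟩
    by_cases htc : t < c
    · exact Or.inl ⟨t, htc, h⟩
    · exact Or.inr ⟨t - s, by omega, by rwa [show s + i + (t - s) = i + t by omega]⟩

theorem orCovers_iff {X E k fuel c R : ℕ} (hck : c ≤ k) (hf : k ≤ c + fuel) (hc : 0 < c)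
    (hR : ∀ i, R.testBit i = true ↔ ∃ t < c, X.testBit (i + t) = true) :
    orCovers E k fuel c R = true ↔
      ∀ i, E.testBit i = true → ∃ t < k, X.testBit (i + t) = true := by
  have last : k - c ≤ c → (Nat.beq (Nat.land (R ||| R >>> (k - c)) E) E = true ↔
      ∀ i, E.testBit i = true → ∃ t < k, X.testBit (i + t) = true) := by
    intro h
    rw [land_eq_right_iff]
    simp only [lor_shiftRight_testBit h hR, Nat.add_sub_cancel' hck]
  induction fuel generalizing c R with
  | zero => exact last (by omega)
  | succ f ih =>
    have step : orCovers E k (f + 1) c R =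
        if 2 * c ≤ k then orCovers E k f (2 * c) (R ||| R >>> c)
        else Nat.beq (Nat.land (R ||| R >>> (k - c)) E) E := by
      change Bool.rec (motive := fun _ => Bool) (Nat.beq (Nat.land (R ||| R >>> (k - c)) E) E)
        (orCovers E k f (2 * c) (R ||| R >>> c)) (Nat.ble (2 * c) k) = _
      cases h : Nat.ble (2 * c) k
      · rw [if_neg]
        intro h'
        rw [Nat.ble_eq_true_of_le h'] at h
        exact absurd h (by decide)
      · rw [if_pos (Nat.le_of_ble_eq_true h)]
    rw [step]
    split_ifs with h
    · have hR' : ∀ i, (R ||| R >>> c).testBit i = true ↔ ∃ t < 2 * c, X.testBit (i + t) = true := by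
        intro i
        rw [two_mul]
        exact lor_shiftRight_testBit le_rfl hR i
      refine ih h (by omega) (by omega) hR' fun h' => ?_
      rw [land_eq_right_iff]
      simp only [lor_shiftRight_testBit h' hR', Nat.add_sub_cancel' h]
    · exact last (by omega)

/-- No square of period `l` in the word encoded by `D` starts at a digit marked in `E`. -/
noncomputable def noSquare (D E l : ℕ) : Bool :=
  force (fun k => force (orCovers E k k 1) (Nat.xor D (Nat.shiftRight D k))) (Nat.mul 2 l)

theorem noSquare_iff {w : List (Fin 3)} {c l : ℕ} (hl : 0 < l) :
    noSquare (enc w) (repOne c) l = true ↔ ∀ q < c, ∃ j < l, w[q + j]? ≠ w[q + l + j]? := by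
  change orCovers (repOne c) (2 * l) (2 * l) 1 (enc w ^^^ enc w >>> (2 * l)) = true ↔ _
  rw [orCovers_iff (X := enc w ^^^ enc w >>> (2 * l)) (by omega) (by omega) one_pos (by simp)]
  have bit : ∀ i, (enc w ^^^ enc w >>> (2 * l)).testBit i = true ↔
      (enc w).testBit i ≠ (enc w).testBit (2 * l + i) := by
    intro i
    rw [Nat.testBit_xor, Nat.testBit_shiftRight]
    cases (enc w).testBit i <;> cases (enc w).testBit (2 * l + i) <;> simp
  simp only [bit, repOne_testBit, ne_eq, getElem?_eq_iff_testBit, not_and_or]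
  constructor
  · intro h q hq
    obtain ⟨t, ht, hne⟩ := h (2 * q) (by omega)
    refine ⟨t / 2, by omega, ?_⟩
    rcases Nat.mod_two_eq_zero_or_one t with h0 | h1
    · left
      convert hne using 3 <;> omega
    · right
      convert hne using 3 <;> omega
  · rintro h i ⟨hi, hi0⟩
    obtain ⟨j, hj, hne | hne⟩ := h (i / 2) (by omega)
    · refine ⟨2 * j, by omega, ?_⟩
      convert hne using 3 <;> omega
    · refine ⟨2 * j + 1, by omega, ?_⟩
      convert hne using 3 <;> omega

/-- Test for square-freeness of the word of length `n` encoded by `N`. -/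
noncomputable def linTest (n N : ℕ) : Bool :=
  allFrom (fun l => force (fun E => noSquare N E l)
    (repOne (Nat.sub (Nat.add n 1) (Nat.mul 2 l)))) (Nat.div n 2) 1

theorem linTest_iff {w : List (Fin 3)} : linTest w.length (enc w) = true ↔ SquareFree w := by
  rw [linTest, allFrom_iff, squareFree_iff]
  change (∀ l, 1 ≤ l → l < 1 + w.length / 2 →
    noSquare (enc w) (repOne (w.length + 1 - 2 * l)) l = true) ↔ _
  constructor
  · intro h q l hl hq
    exact (noSquare_iff hl).1 (h l hl (by omega)) q (by omega)
  · intro h l hl hlw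
    exact (noSquare_iff hl).2 fun q hq => h q l hl (by omega)

/-- Test for square-freeness of the circular word of length `n` encoded by `N`. -/
noncomputable def circTest (n N : ℕ) : Bool :=
  force (fun D => force (fun E => allFrom (noSquare D E) (Nat.div n 2) 1) (repOne n))
    (Nat.add N (Nat.mul (Nat.pow 4 n) N))

theorem circTest_iff {w : List (Fin 3)} :
    circTest w.length (enc w) = true ↔ CircSquareFree w := by
  rw [circSquareFree_iff_append_self]
  change allFrom (noSquare (enc w + 4 ^ w.length * enc w) (repOne w.length)) (w.length / 2) 1 = true
    ↔ _
  rw [← enc_append, allFrom_iff]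
  constructor
  · intro h l hl hlw
    exact (noSquare_iff hl).1 (h l hl (by omega))
  · intro h l hl hlw
    exact (noSquare_iff hl).2 (h l hl (by omega))

/-- Test whether no letter can be put in front of a conjugate of the circular word of length `n`
encoded by `N` without creating a square. -/
noncomputable def blockedTest (n N : ℕ) : Bool :=
  allFrom (fun j => force (fun y => allFrom (fun a => force (fun M =>
      Bool.rec true false (circTest (Nat.add n 1) M)) (Nat.add a (Nat.mul 4 y))) 3 1)
    (Nat.add (Nat.div N (Nat.pow 4 j))
      (Nat.mul (Nat.pow 4 (Nat.sub n j)) (Nat.mod N (Nat.pow 4 j))))) (Nat.add n 1) 0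

theorem boolRec_true_false_iff {b : Bool} :
    Bool.rec (motive := fun _ => Bool) true false b = true ↔ ¬ b = true := by
  cases b <;> simp

theorem blockedTest_iff {w : List (Fin 3)} : blockedTest w.length (enc w) = true ↔
    ∀ y, y ~r w → ∀ a, ¬ CircSquareFree (a :: y) := by
  rw [blockedTest, allFrom_iff]
  simp only [force_eq, allFrom_iff, boolRec_true_false_iff]
  have hrot : ∀ j ≤ w.length, enc (w.rotate j) =
      enc w / 4 ^ j + 4 ^ (w.length - j) * (enc w % 4 ^ j) := by
    intro j hj
    rw [List.rotate_eq_drop_append_take hj, enc_append, enc_drop, enc_take, List.length_drop]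
  have key : ∀ j ≤ w.length, ∀ a : Fin 3, circTest (w.length + 1)
      ((a.val + 1) + 4 * (enc w / 4 ^ j + 4 ^ (w.length - j) * (enc w % 4 ^ j))) = true ↔
        CircSquareFree (a :: w.rotate j) := by
    intro j hj a
    rw [← circTest_iff, enc, hrot j hj, List.length_cons, List.length_rotate]
  constructor
  · intro h y hy a
    obtain ⟨j, hj, rfl⟩ := List.isRotated_iff_mod.1 hy.symm
    rw [← key j hj a]
    exact h j (by omega) (by simp; omega) (a.val + 1) (by omega) (by omega)
  · intro h j _ hj a ha ha'
    have hj' : j ≤ w.length := by simpa [Nat.lt_succ_iff] using hj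
    have := h (w.rotate j) (List.IsRotated.symm ⟨j, rfl⟩) ⟨a - 1, by omega⟩
    rw [← key j hj', Nat.sub_add_cancel ha] at this
    exact this

/-- Test for extremality of the circular word of length `n` encoded by `N`. -/
noncomputable def extremalTest (n N : ℕ) : Bool :=
  Bool.rec false (blockedTest n N) (circTest n N)

theorem extremalTest_iff {w : List (Fin 3)} :
    extremalTest w.length (enc w) = true ↔ ExtremalCircSquareFree w := by
  rw [extremalCircSquareFree_iff, ← circTest_iff, ← blockedTest_iff, extremalTest]
  cases circTest w.length (enc w) <;> simp

/-! ### Lengths without extremal words -/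

/-- Test that the word encoded by `N` does not start with a square whose period is one of the
exponents of the powers of `4` in `ps`. -/
noncomputable def noPrefixSquare (ps : List ℕ) (N : ℕ) : Bool :=
  List.rec (motive := fun _ => Bool) true
    (fun P _ ih => Bool.rec ih false (Nat.beq (Nat.mod N P) (Nat.mod (Nat.div N P) P))) ps

theorem SquareFree.noPrefixSquare {w : List (Fin 3)} (hw : SquareFree w) (hne : w ≠ [])
    {ps : List ℕ} (hps : ∀ P ∈ ps, ∃ l, P = 4 ^ (l + 1)) : noPrefixSquare ps (enc w) = true := by
  induction ps with
  | nil => rfl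
  | cons P ps ih =>
    have step : _root_.noPrefixSquare (P :: ps) (enc w) =
        Bool.rec (motive := fun _ => Bool) (_root_.noPrefixSquare ps (enc w)) false
          (Nat.beq (enc w % P) (enc w / P % P)) := rfl
    rw [step]
    cases h : Nat.beq (enc w % P) (enc w / P % P)
    · exact ih fun Q hQ => hps Q (List.mem_cons_of_mem P hQ)
    · exfalso
      obtain ⟨l, rfl⟩ := hps P List.mem_cons_self
      have h' := Nat.eq_of_beq_eq_true h
      rw [← enc_drop, ← enc_take, ← enc_take] at h'
      have e := enc_injective h'
      refine hw (w.take (l + 1)) (by simpa using hne) ⟨[], (w.drop (l + 1)).drop (l + 1), ?_⟩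
      conv_lhs => rw [List.nil_append]; enter [1, 2]; rw [e]
      rw [List.append_assoc, List.take_append_drop, List.take_append_drop]

/-- Test all words obtained by prepending `fuel` letters to the word encoded by a given number,
skipping words that are seen to contain squares. -/
noncomputable def prependAll (ps : List ℕ) (test : ℕ → Bool) (fuel : ℕ) : ℕ → Bool :=
  Nat.rec (motive := fun _ => ℕ → Bool) test
    (fun _ ih N => allFrom (fun a => force (fun M => Bool.rec true (ih M) (noPrefixSquare ps M))
      (Nat.add a (Nat.mul 4 N))) 3 1) fuel

theorem prependAll_sound {ps : List ℕ} (hps : ∀ P ∈ ps, ∃ l, P = 4 ^ (l + 1)) {test : ℕ → Bool}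
    {fuel : ℕ} {w : List (Fin 3)} (h : prependAll ps test fuel (enc w) = true)
    {v : List (Fin 3)} (hv : v.length = fuel) (hsq : SquareFree (v ++ w)) :
    test (enc (v ++ w)) = true := by
  induction fuel generalizing v w with
  | zero =>
    rw [List.length_eq_zero_iff] at hv
    subst hv
    exact h
  | succ f ih =>
    obtain ⟨v, a, rfl⟩ := (List.eq_nil_or_concat v).resolve_left (by rintro rfl; simp at hv)
    rw [List.concat_eq_append, List.append_assoc] at *
    have h' : allFrom (fun a => Bool.rec (motive := fun _ => Bool) true
        (prependAll ps test f (a + 4 * enc w)) (noPrefixSquare ps (a + 4 * enc w))) 3 1 = true := h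
    have h1 := allFrom_iff.1 h' (a.val + 1) (by omega) (by omega)
    change Bool.rec (motive := fun _ => Bool) true (prependAll ps test f (enc (a :: w)))
      (noPrefixSquare ps (enc (a :: w))) = true at h1
    have haw : SquareFree (a :: w) := hsq.of_infix (List.suffix_append v ([a] ++ w)).isInfix
    rw [haw.noPrefixSquare (by simp) hps] at h1
    exact ih h1 (by simpa using hv) hsq

/-- The powers of `4` whose exponents are the possible periods of squares in words of length at
most `37`. -/
def fourPowers : List ℕ :=
  [4, 16, 64, 256, 1024, 4096, 16384, 65536, 262144, 1048576, 4194304, 16777216, 67108864,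
    268435456, 1073741824, 4294967296, 17179869184, 68719476736]

theorem fourPowers_spec : ∀ P ∈ fourPowers, ∃ l, P = 4 ^ (l + 1) := by
  have h : ∀ P ∈ fourPowers, ∃ l < 18, P = 4 ^ (l + 1) := by decide +kernel
  exact fun P hP => (h P hP).imp fun _ => And.right

/-- No extremal circular word of length `n` arises by prepending `fuel` letters to the word
encoded by `N`. -/
noncomputable def noExtremalTest (n fuel N : ℕ) : Bool :=
  prependAll fourPowers (fun M => Bool.rec true false (extremalTest n M)) fuel N

theorem noExtremalTest_sound {v w : List (Fin 3)} {n fuel : ℕ}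
    (h : noExtremalTest n fuel (enc w) = true) (hv : v.length = fuel)
    (hn : (v ++ w).length = n) : ¬ ExtremalCircSquareFree (v ++ w) := by
  intro hext
  have := prependAll_sound fourPowers_spec h hv hext.1.squareFree
  rw [boolRec_true_false_iff, ← hn, extremalTest_iff] at this
  exact this hext

/-- A circular square-free ternary word has a conjugate ending in `cabac`, where `a`, `b`, `c` are
the three letters. -/
theorem CircSquareFree.exists_isRotated_append {w : List (Fin 3)} (hw : CircSquareFree w)
    (hlen : 6 ≤ w.length) : ∃ (v : List (Fin 3)) (a b c : Fin 3),
      a ≠ b ∧ b ≠ c ∧ a ≠ c ∧ v ++ [c, a, b, a, c] ~r w := by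
  have hg : ∀ i, ∃ x, cyc w i = some x := by
    intro i
    have : i % w.length < w.length := Nat.mod_lt _ (by omega)
    exact ⟨_, List.getElem?_eq_getElem this⟩
  choose g hg using hg
  rw [circSquareFree_iff] at hw
  have h1 : ∀ i, g i ≠ g (i + 1) := by
    intro i
    obtain ⟨j, hj, h⟩ := hw i 1 one_pos (by omega)
    obtain rfl : j = 0 := by omega
    simpa [hg] using h
  have h2 : ∀ i, g i = g (i + 2) → g (i + 1) ≠ g (i + 3) := by
    intro i hi hi'
    obtain ⟨j, hj, h⟩ := hw i 2 two_pos (by omega)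
    interval_cases j <;> simp_all [add_assoc]
  have h3 : ∃ i, g (i + 1) = g (i + 3) := by
    by_contra! hcon
    obtain ⟨j, hj, h⟩ := hw 1 3 three_pos (by omega)
    apply h
    rw [hg, hg]
    have e1 := h1 (1 + j)
    have e2 := h1 (2 + j)
    have e3 := h1 (3 + j)
    have e4 := hcon j
    have e5 := hcon (j + 1)
    rw [show j + 1 = 1 + j by ring, show j + 3 = 3 + j by ring] at e4
    rw [show j + 1 + 1 = 2 + j by ring, show j + 1 + 3 = 4 + j by ring] at e5
    rw [show 1 + j + 1 = 2 + j by ring] at e1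
    rw [show 2 + j + 1 = 3 + j by ring] at e2
    rw [show 3 + j + 1 = 4 + j by ring] at e3
    rw [show 1 + 3 + j = 4 + j by ring]
    generalize g (1 + j) = x, g (2 + j) = y, g (3 + j) = z, g (4 + j) = t at *
    congr 1
    omega
  obtain ⟨i, hi⟩ := h3
  have d1 := h1 i
  have d2 := h1 (i + 1)
  have d3 := h1 (i + 3)
  have d4 : g i ≠ g (i + 2) := fun h => h2 i h hi
  have d5 := h2 (i + 1) hi
  have hc : g (i + 4) = g i := by
    simp only [add_assoc, Nat.reduceAdd] at d1 d2 d3 d4 d5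
    generalize g i = x, g (i + 1) = y, g (i + 2) = z, g (i + 3) = t, g (i + 4) = s at *
    omega
  refine ⟨(w.rotate (i + 5)).take (w.length - 5), g (i + 1), g (i + 2), g i, d2, d4.symm, d1.symm,
    ?_⟩
  have hd : (w.rotate (i + 5)).drop (w.length - 5) =
      [g i, g (i + 1), g (i + 2), g (i + 1), g i] := by
    apply List.ext_getElem?
    intro k
    rw [List.getElem?_drop]
    by_cases hk : k < 5
    · rw [getElem?_rotate (by omega), show i + 5 + (w.length - 5 + k) = i + k + w.length by omega,
        cyc_add_length, hg]
      interval_cases k <;> simp [← hi, hc]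
    · rw [List.getElem?_eq_none (by simp; omega), List.getElem?_eq_none (by simp; omega)]
  rw [← hd, List.take_append_drop]
  exact List.IsRotated.symm ⟨_, rfl⟩

theorem exists_perm_eq : ∀ a b c : Fin 3, a ≠ b → b ≠ c → a ≠ c →
    ∃ e : Equiv.Perm (Fin 3), e a = 0 ∧ e b = 1 ∧ e c = 2 := by
  decide

theorem not_extremal_of_test {w : List (Fin 3)} (hlen : 6 ≤ w.length)
    (h : noExtremalTest w.length (w.length - 5) (enc [2, 0, 1, 0, 2]) = true) :
    ¬ ExtremalCircSquareFree w := by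
  intro hw
  obtain ⟨v, a, b, c, hab, hbc, hac, hrot⟩ := hw.1.exists_isRotated_append hlen
  obtain ⟨e, ha, hb, hc⟩ := exists_perm_eq a b c hab hbc hac
  have hext := (hw.of_isRotated hrot).map_equiv e
  have hl := hrot.perm.length_eq
  simp only [List.map_append, List.map_cons, List.map_nil, ha, hb, hc] at hext
  simp only [List.length_append, List.length_cons, List.length_nil] at hl
  refine noExtremalTest_sound h ?_ ?_ hext <;> simp <;> omega

theorem not_extremal_of_test_nil {w : List (Fin 3)}
    (h : noExtremalTest w.length w.length 0 = true) : ¬ ExtremalCircSquareFree w := by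
  simpa using noExtremalTest_sound (v := w) (w := []) h rfl (by simp)

/-- The lengths above `5` that are not the length of an extremal circular word. -/
theorem noExtremalTest_eq_true : ∀ n ∈ [7, 9, 10, 11, 12, 14, 17, 19, 25, 26, 27, 29, 31],
    noExtremalTest n (n - 5) (enc [2, 0, 1, 0, 2]) = true := by
  decide +kernel

theorem noExtremalTest_thirtySeven : noExtremalTest 37 32 (enc [2, 0, 1, 0, 2]) = true := by
  decide +kernel

theorem noExtremalTest_nil : ∀ n ∈ [0, 1, 2, 3, 5], noExtremalTest n n 0 = true := by
  decide +kernel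

/-! ### Square-free sequences of blocks -/

/-- A square in a sequence `W` that is cut at the positions `S i` into blocks, where block starts
are marked by a common prefix of length `r`, comes from a square in the sequence `b` of blocks, if
blocks are determined by their first `dp` and by their last `ds` letters and two consecutive blocks
with the next marker contain no square. -/
theorem exists_square_of_blocks {β γ : Type*} {W : ℕ → β} {b : ℕ → γ} {S : ℕ → ℕ} {r dp ds : ℕ}
    (hr : 0 < r) (hds : 0 < ds)
    (hSr : ∀ i, S i + r ≤ S (i + 1)) (hS : ∀ i, S i + dp + ds ≤ S (i + 1) + 1)
    (sync : ∀ i q, S 0 ≤ q → (∀ j < r, W (q + j) = W (S i + j)) → ∃ k, q = S k)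
    (pre : ∀ i k, (∀ j < dp, W (S i + j) = W (S k + j)) → b i = b k)
    (suf : ∀ i k, (∀ j < ds, W (S (i + 1) - 1 - j) = W (S (k + 1) - 1 - j)) → b i = b k)
    (len : ∀ i k, b i = b k → S (i + 1) + S k = S (k + 1) + S i)
    (small : ∀ i q l, 0 < l → S i ≤ q → q + 2 * l < S (i + 2) + r →
      ∃ j < l, W (q + j) ≠ W (q + l + j))
    {q l : ℕ} (hl : 0 < l) (hq : S 1 ≤ q) (hsq : ∀ j < l, W (q + j) = W (q + l + j)) :
    ∃ i m e, 0 < m ∧ (∀ j < m, b (i + j) = b (i + m + j)) ∧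
      q ≤ S (i + e) ∧ S (i + e + 2 * m - 1) < q + 2 * l := by
  have hmono : StrictMono S := strictMono_nat_of_lt_succ fun i => by have := hSr i; omega
  have hshift : ∀ x, q ≤ x → x < q + l → W x = W (x + l) := by
    intro x h1 h2
    have := hsq (x - q) (by omega)
    rwa [show q + (x - q) = x by omega, show q + l + (x - q) = x + l by omega] at this
  -- a block start in the second half of the square can be moved to the first half
  have hback : ∀ i, q + l ≤ S i → S i + r ≤ q + 2 * l → ∃ k, S i = S k + l := by
    intro i h1 h2
    have h01 := hmono (show 0 < 1 by omega)
    obtain ⟨k, hk⟩ := sync i (S i - l) (by omega) (fun j hj => by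
      rw [hshift _ (by omega) (by omega)]
      congr 1
      omega)
    exact ⟨k, by omega⟩
  have hex : ∃ i, q ≤ S i := ⟨q, hmono.id_le q⟩
  classical
  set i₁ := Nat.find hex with hi₁
  have hq₁ : q ≤ S i₁ := Nat.find_spec hex
  have hmin : ∀ k, q ≤ S k → i₁ ≤ k := fun k hk => Nat.find_min' hex hk
  have hpos : 0 < i₁ := by
    by_contra h0
    have h01 := hmono (show 0 < 1 by omega)
    rw [show i₁ = 0 by omega] at hq₁
    omega
  by_cases hin : S i₁ + r ≤ q + l
  swap
  · exfalso
    have hprev : S (i₁ - 1) < q := by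
      by_contra! h
      have := hmin _ h
      omega
    have h1 := hSr i₁
    obtain ⟨j, hj, hne⟩ := small (i₁ - 1) q l hl hprev.le (by
      rw [show i₁ - 1 + 2 = i₁ + 1 by omega]
      by_contra! h2
      obtain ⟨k, hk⟩ := hback (i₁ + 1) (by omega) h2
      have h3 := hmin k (by omega)
      have h4 := hmono.monotone h3
      omega)
    exact hne (hsq j hj)
  obtain ⟨i₂, hi₂⟩ := sync i₁ (S i₁ + l) (by have := hmono.monotone (Nat.zero_le i₁); omega)
    (fun j hj => by
      rw [hshift (S i₁ + j) (by omega) (by omega)]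
      congr 1
      omega)
  have hlt : i₁ < i₂ := hmono.lt_iff_lt.1 (by omega)
  obtain ⟨m, rfl⟩ : ∃ m, i₂ = i₁ + (m + 1) := ⟨i₂ - i₁ - 1, by omega⟩
  have hlast : S (i₁ + m) < q + l := by
    by_contra! h
    have h1 := hSr (i₁ + m)
    rw [add_assoc] at h1
    obtain ⟨k, hk⟩ := hback (i₁ + m) h (by omega)
    have h2 := hmono.monotone (hmin k (by omega))
    omega
  have hd : ∀ d ≤ m, S (i₁ + d) + l = S (i₁ + (m + 1) + d) ∧
      ∀ k < d, b (i₁ + k) = b (i₁ + (m + 1) + k) := by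
    intro d
    induction d with
    | zero => exact fun _ => ⟨hi₂, fun k hk => by omega⟩
    | succ d ih =>
      intro hdm
      obtain ⟨ih1, ih2⟩ := ih (by omega)
      have h1 := hS (i₁ + d)
      have h2 : S (i₁ + d + 1) ≤ S (i₁ + m) := hmono.monotone (by omega)
      have h3 : S i₁ ≤ S (i₁ + d) := hmono.monotone (by omega)
      have hb : b (i₁ + d) = b (i₁ + (m + 1) + d) := by
        apply pre
        intro j hj
        rw [hshift _ (by omega) (by omega), ← ih1]
        congr 1
        omega
      have h4 := len _ _ hb
      refine ⟨by rw [← add_assoc, ← add_assoc]; omega, fun k hk => ?_⟩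
      rcases Nat.lt_succ_iff_lt_or_eq.1 hk with h | rfl
      · exact ih2 k h
      · exact hb
  obtain ⟨hend, hblocks⟩ := hd m le_rfl
  have h3 : S i₁ ≤ S (i₁ + m) := hmono.monotone (by omega)
  by_cases hcase : S (i₁ + m) + dp ≤ q + l
  · refine ⟨i₁, m + 1, 0, by omega, fun j hj => ?_, hq₁, ?_⟩
    · rcases Nat.lt_succ_iff_lt_or_eq.1 hj with h | rfl
      · exact hblocks j h
      · apply pre
        intro k hk
        rw [hshift _ (by omega) (by omega), ← hend]
        congr 1
        omega
    · rw [show i₁ + 0 + 2 * (m + 1) - 1 = i₁ + (m + 1) + m by omega]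
      omega
  · have h4 := hS (i₁ + m)
    rw [add_assoc i₁] at h4
    have hfirst : b (i₁ - 1) = b (i₁ + m) := by
      apply suf
      intro j hj
      rw [Nat.sub_add_cancel hpos, hshift _ (by omega) (by omega), add_assoc i₁, ← hi₂]
      congr 1
      omega
    refine ⟨i₁ - 1, m + 1, 1, by omega, fun j hj => ?_, ?_, ?_⟩
    · rcases Nat.eq_zero_or_pos j with rfl | hj0
      · rw [add_zero, add_zero, hfirst]
        congr 1
        omega
      · have := hblocks (j - 1) (by omega)
        rwa [show i₁ + (j - 1) = i₁ - 1 + j by omega,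
          show i₁ + (m + 1) + (j - 1) = i₁ - 1 + (m + 1) + j by omega] at this
    · rwa [Nat.sub_add_cancel hpos]
    · rw [show i₁ - 1 + 1 + 2 * (m + 1) - 1 = i₁ + (m + 1) + m by omega]
      omega

section Blocks

variable {α : Type*}

/-- The `i`-th block of a circular list of blocks. -/
def cycBlock (L : List (List α)) (i : ℕ) : List α := L.getD (i % L.length) []

/-- The position at which the `i`-th block of a circular list of blocks starts. -/
def blockStart (L : List (List α)) (i : ℕ) : ℕ := ∑ k ∈ Finset.range i, (cycBlock L k).length

theorem blockStart_succ (L : List (List α)) (i : ℕ) :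
    blockStart L (i + 1) = blockStart L i + (cycBlock L i).length :=
  Finset.sum_range_succ _ _

variable {L : List (List α)}

theorem cyc_eq_some_cycBlock (hL : L ≠ []) (i : ℕ) : cyc L i = some (cycBlock L i) := by
  have h : i % L.length < L.length := Nat.mod_lt _ (List.length_pos_iff.2 hL)
  simp [cyc, cycBlock, List.getD, List.getElem?_eq_getElem h]

theorem cycBlock_mem (hL : L ≠ []) (i : ℕ) : cycBlock L i ∈ L :=
  List.mem_of_getElem? (cyc_eq_some_cycBlock hL i)

theorem exists_rotate_eq_cons (hL : L ≠ []) (i : ℕ) : ∃ M, L.rotate i = cycBlock L i :: M := by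
  have h := getElem?_rotate (List.length_pos_iff.2 hL) i
  rw [add_zero, cyc_eq_some_cycBlock hL] at h
  cases hr : L.rotate i with
  | nil => simp [hr] at h
  | cons B M => exact ⟨M, by simpa [hr] using h⟩

theorem blockStart_add_length (i : ℕ) :
    blockStart L (i + L.length) = blockStart L i + L.flatten.length := by
  induction i with
  | zero =>
    have h : ∀ k ≤ L.length, blockStart L k = (L.take k).flatten.length := by
      intro k
      induction k with
      | zero => simp [blockStart]
      | succ k ih =>
        intro hk
        rw [blockStart_succ, ih (by omega), List.take_add_one, List.flatten_append,
          List.length_append, cycBlock, Nat.mod_eq_of_lt (by omega)]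
        simp [List.getD, List.getElem?_eq_getElem (show k < L.length by omega)]
    rw [zero_add, h _ le_rfl, List.take_length]
    simp [blockStart]
  | succ i ih =>
    have h : cycBlock L (i + L.length) = cycBlock L i := by simp [cycBlock]
    rw [add_right_comm, blockStart_succ, ih, blockStart_succ, h]
    ring

theorem flatten_rotate (i : ℕ) : (L.rotate i).flatten = L.flatten.rotate (blockStart L i) := by
  rcases eq_or_ne L [] with rfl | hL
  · simp
  induction i with
  | zero => simp [blockStart]
  | succ i ih =>
    obtain ⟨M, hM⟩ := exists_rotate_eq_cons hL i
    rw [← List.rotate_rotate, hM, blockStart_succ, ← List.rotate_rotate, ← ih, hM]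
    simp [List.rotate_append_length_eq]

theorem cyc_flatten (hL : L ≠ []) {i j : ℕ} (hj : j < (cycBlock L i).length) :
    cyc L.flatten (blockStart L i + j) = (cycBlock L i)[j]? := by
  obtain ⟨M, hM⟩ := exists_rotate_eq_cons hL i
  have e := flatten_rotate (L := L) i
  have hn : j < L.flatten.length := by
    rw [← List.length_rotate (l := L.flatten) (n := blockStart L i), ← e, hM]
    simp
    omega
  rw [← getElem?_rotate hn, ← e, hM, List.flatten_cons, List.getElem?_append_left hj]

theorem cyc_flatten_prefix (hL : L ≠ []) {p : List α} {i j : ℕ} (hp : p <+: cycBlock L i)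
    (hj : j < p.length) : cyc L.flatten (blockStart L i + j) = p[j]? := by
  obtain ⟨t, ht⟩ := hp
  rw [cyc_flatten hL (by rw [← ht, List.length_append]; omega), ← ht,
    List.getElem?_append_left hj]

theorem cyc_flatten_append (hL : L ≠ []) {p : List α} (hp : ∀ B ∈ L, p <+: B) {i j : ℕ}
    (hj : j < (cycBlock L i ++ p).length) :
    cyc L.flatten (blockStart L i + j) = (cycBlock L i ++ p)[j]? := by
  by_cases h : j < (cycBlock L i).length
  · rw [cyc_flatten hL h, List.getElem?_append_left h]
  · rw [List.length_append] at hj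
    rw [List.getElem?_append_right (by omega),
      ← cyc_flatten_prefix hL (hp _ (cycBlock_mem hL (i + 1))) (by omega), blockStart_succ]
    congr 1
    omega

theorem cyc_flatten_append_append (hL : L ≠ []) {p : List α} (hp : ∀ B ∈ L, p <+: B) {i j : ℕ}
    (hj : j < (cycBlock L i ++ (cycBlock L (i + 1) ++ p)).length) :
    cyc L.flatten (blockStart L i + j) = (cycBlock L i ++ (cycBlock L (i + 1) ++ p))[j]? := by
  by_cases h : j < (cycBlock L i).length
  · rw [cyc_flatten hL h, List.getElem?_append_left h]
  · rw [List.length_append] at hj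
    rw [List.getElem?_append_right (by omega), ← cyc_flatten_append hL hp (by omega),
      blockStart_succ]
    congr 1
    omega

/-- A circular square-free list of blocks with a synchronizing prefix `p`, determined by their
first `dp` and by their last `ds` letters, gives a circular square-free word. -/
theorem CircSquareFree.flatten {p : List α} {dp ds : ℕ} (hcs : CircSquareFree L)
    (hK : 2 ≤ L.length) (hp0 : p ≠ []) (hdp : 0 < dp) (hds : 0 < ds)
    (hp : ∀ B ∈ L, p <+: B)
    (hlen : ∀ B ∈ L, dp + ds ≤ B.length + 1)
    (sync : ∀ B ∈ L, ∀ o, p <+: (B ++ p).drop o → o = 0 ∨ o = B.length)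
    (pre : ∀ B ∈ L, ∀ C ∈ L, B.take dp = C.take dp → B = C)
    (suf : ∀ B ∈ L, ∀ C ∈ L, B.drop (B.length - ds) = C.drop (C.length - ds) → B = C)
    (small : ∀ B ∈ L, ∀ C ∈ L, B ≠ C → SquareFree (B ++ (C ++ p.dropLast))) :
    CircSquareFree L.flatten := by
  have hL : L ≠ [] := by rintro rfl; simp at hK
  have hmem := cycBlock_mem hL
  have hr : 0 < p.length := List.length_pos_iff.2 hp0
  have hS0 : blockStart L 0 = 0 := by simp [blockStart]
  have hSr : ∀ i, blockStart L i + p.length ≤ blockStart L (i + 1) := fun i => by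
    rw [blockStart_succ]
    exact Nat.add_le_add_left (hp _ (hmem i)).length_le _
  have hmono : StrictMono (blockStart L) :=
    strictMono_nat_of_lt_succ fun i => by have := hSr i; omega
  have hadj : ∀ i, cycBlock L i ≠ cycBlock L (i + 1) := by
    intro i
    obtain ⟨j, hj, h⟩ := circSquareFree_iff.1 hcs i 1 one_pos hK
    obtain rfl : j = 0 := by omega
    simpa [cyc_eq_some_cycBlock hL] using h
  rw [circSquareFree_iff]
  intro q l hl hlw
  by_contra! hsq
  have hpos : 0 < L.flatten.length := by omega
  have hn := blockStart_add_length (L := L)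
  obtain ⟨i, m, e, hm, hb, hq, hend⟩ := exists_square_of_blocks (W := cyc L.flatten)
    (b := cycBlock L) (S := blockStart L) (r := p.length) (dp := dp) (ds := ds)
    (q := q + blockStart L 1 * L.flatten.length) (l := l) hr hds hSr
    (fun i => by
      have := hlen _ (hmem i)
      rw [blockStart_succ]
      omega)
    (by
      intro i q _ h
      have hex : ∃ k, q < blockStart L (k + 1) := ⟨q, (hmono.id_le (q + 1))⟩
      classical
      set k := Nat.find hex
      have hk : q < blockStart L (k + 1) := Nat.find_spec hex
      have hk' : blockStart L k ≤ q := by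
        rcases Nat.eq_zero_or_pos k with h0 | h0
        · rw [h0, hS0]; omega
        · by_contra! hlt
          have := Nat.find_min' hex (m := k - 1) (by rwa [Nat.sub_add_cancel h0])
          omega
      rw [blockStart_succ] at hk
      have hpre : p <+: (cycBlock L k ++ p).drop (q - blockStart L k) := by
        rw [List.prefix_iff_getElem?]
        intro j hj
        rw [List.getElem?_drop, ← cyc_flatten_append hL hp (by rw [List.length_append]; omega),
          ← add_assoc, Nat.add_sub_cancel' hk', h j hj,
          cyc_flatten_prefix hL (hp _ (hmem i)) hj, List.getElem?_eq_getElem hj]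
      rcases sync _ (hmem k) _ hpre with h0 | h1
      · exact ⟨k, by omega⟩
      · omega)
    (by
      intro i k h
      have hi := hlen _ (hmem i)
      have hk := hlen _ (hmem k)
      apply pre _ (hmem i) _ (hmem k)
      apply List.ext_getElem?
      intro j
      by_cases hj : j < dp
      · rw [List.getElem?_take_of_lt hj, List.getElem?_take_of_lt hj,
          ← cyc_flatten hL (by omega), ← cyc_flatten hL (by omega), h j hj]
      · rw [List.getElem?_take_eq_none (by omega), List.getElem?_take_eq_none (by omega)])
    (by
      intro i k h
      have hi := hlen _ (hmem i)
      have hk := hlen _ (hmem k)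
      apply suf _ (hmem i) _ (hmem k)
      apply List.ext_getElem?
      intro j
      rw [List.getElem?_drop, List.getElem?_drop]
      by_cases hj : j < ds
      · rw [← cyc_flatten hL (by omega), ← cyc_flatten hL (by omega)]
        have h' := h (ds - 1 - j) (by omega)
        rw [blockStart_succ, blockStart_succ] at h'
        convert h' using 2 <;> omega
      · rw [List.getElem?_eq_none (by omega), List.getElem?_eq_none (by omega)])
    (fun i k h => by
      rw [blockStart_succ, blockStart_succ, h]
      ring)
    (by
      intro i q l hl hq hq'
      rw [show i + 2 = i + 1 + 1 by ring, blockStart_succ, blockStart_succ] at hq'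
      have hle : q - blockStart L i + 2 * l ≤
          (cycBlock L i ++ (cycBlock L (i + 1) ++ p.dropLast)).length := by
        simp only [List.length_append, List.length_dropLast]
        omega
      obtain ⟨j, hj, hne⟩ := squareFree_iff.1 (small _ (hmem i) _ (hmem (i + 1)) (hadj i))
        (q - blockStart L i) l hl hle
      have hp' : ∀ B ∈ L, p.dropLast <+: B := fun B hB => (List.dropLast_prefix p).trans (hp B hB)
      refine ⟨j, hj, ?_⟩
      rwa [← cyc_flatten_append_append hL hp' (by omega),
        ← cyc_flatten_append_append hL hp' (by omega),
        show blockStart L i + (q - blockStart L i + j) = q + j by omega,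
        show blockStart L i + (q - blockStart L i + l + j) = q + l + j by omega] at hne)
    hl (by nlinarith) (fun j hj => by
      have h := hsq j hj
      have hc : ∀ x c, cyc L.flatten (x + c * L.flatten.length) = cyc L.flatten x := by
        simp [cyc]
      rw [add_right_comm, hc, h, ← hc (q + l + j) (blockStart L 1)]
      congr 1
      ring)
  have hmK : 2 * m ≤ L.length := by
    have h := hn (i + e)
    have hlt : i + e + 2 * m - 1 < i + e + L.length := hmono.lt_iff_lt.1 (by omega)
    omega
  obtain ⟨j, hj, hne⟩ := circSquareFree_iff.1 hcs i m hm hmK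
  rw [cyc_eq_some_cycBlock hL, cyc_eq_some_cycBlock hL, hb j hj] at hne
  exact hne rfl

end Blocks

/-! ### Extremal words from blocks -/

section Construction

variable {α : Type*}

/-- Appending a new letter to a square-free word gives a circular square-free word. -/
theorem SquareFree.circSquareFree_append {u : List α} (hu : SquareFree u) {x : α} (hx : x ∉ u) :
    CircSquareFree (u ++ [x]) := by
  have hxiff : ∀ i, i % (u.length + 1) ≠ u.length → cyc (u ++ [x]) i ≠ some x := by
    intro i hi hc
    have hlt := Nat.mod_lt i (show 0 < u.length + 1 by omega)
    rw [cyc, List.length_append, List.length_singleton, List.getElem?_append_left (by omega)] at hc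
    exact hx (List.mem_of_getElem? hc)
  have hxu : cyc (u ++ [x]) u.length = some x := by simp [cyc]
  rw [circSquareFree_iff_append_self]
  intro l hl hlw q hq
  rw [List.length_append, List.length_singleton] at hlw hq
  by_contra! hcon
  have hsq : ∀ j < l, cyc (u ++ [x]) (q + j) = cyc (u ++ [x]) (q + l + j) := by
    intro j hj
    have h := hcon j hj
    rwa [getElem?_append_self (by simp; omega), getElem?_append_self (by simp; omega)] at h
  by_cases h : q + 2 * l ≤ u.length
  · obtain ⟨j, hj, hne⟩ := squareFree_iff.1 hu q l hl h
    apply hne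
    have h' := hcon j hj
    rwa [List.append_assoc, List.getElem?_append_left (by omega),
      List.getElem?_append_left (by omega)] at h'
  by_cases h' : q + l ≤ u.length
  · have e := hsq (u.length - (q + l)) (by omega)
    rw [show q + l + (u.length - (q + l)) = u.length by omega, hxu] at e
    exact hxiff _ (by rw [Nat.mod_eq_of_lt (by omega)]; omega) e
  · have e := hsq (u.length - q) (by omega)
    rw [show q + (u.length - q) = u.length by omega, hxu,
      show q + l + (u.length - q) = l - 1 + (u.length + 1) by omega] at e
    exact hxiff _ (by rw [Nat.add_mod_right, Nat.mod_eq_of_lt (by omega)]; omega) e.symm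

theorem exists_eq_append_append {p s R : List α} (hp : p <+: R) (hs : s <:+ R)
    (hlen : p.length + s.length ≤ R.length) : ∃ z, R = p ++ (z ++ s) := by
  obtain ⟨t, rfl⟩ := hp
  rw [List.length_append] at hlen
  obtain ⟨z, rfl⟩ : s <:+ t :=
    List.suffix_of_suffix_length_le hs (List.suffix_append p t) (by omega)
  exact ⟨z, rfl⟩

/-- If inserting a letter into a block, seen between the common suffix `s` and the common prefix
`p` of the blocks, always creates a square, then so does inserting a letter into a circular
sequence of blocks. -/
theorem not_circSquareFree_cons_of_blocks {L : List (List α)} (hK : 2 ≤ L.length) {p s : List α}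
    (hp : ∀ B ∈ L, p <+: B) (hs : ∀ B ∈ L, s <:+ B)
    (hlen : ∀ B ∈ L, p.length + s.length ≤ B.length)
    (hins : ∀ B ∈ L, ∀ B₁ B₂ a, B = B₁ ++ B₂ → ¬ SquareFree ((s ++ B₁) ++ a :: (B₂ ++ p)))
    {y : List α} (hy : y ~r L.flatten) (a : α) : ¬ CircSquareFree (a :: y) := by
  have key : ∀ B ∈ L, ∀ B₁ B₂, B = B₁ ++ B₂ → ∀ M : List (List α), M ≠ [] → (∀ C ∈ M, C ∈ L) →
      ¬ CircSquareFree (a :: (B₂ ++ (M.flatten ++ B₁))) := by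
    intro B hB B₁ B₂ e M hM hML hc
    have h1 : p <+: M.flatten := by
      obtain ⟨C, M', rfl⟩ := List.exists_cons_of_ne_nil hM
      exact (hp C (hML C (by simp))).trans (List.prefix_append _ _)
    have h2 : s <:+ M.flatten ∧ p.length + s.length ≤ M.flatten.length := by
      obtain ⟨M', C, rfl⟩ := (List.eq_nil_or_concat M).resolve_left hM
      have hC : C ∈ L := hML C (by simp)
      have hl := hlen C hC
      constructor
      · simpa using (hs C hC).trans (List.suffix_append _ _)
      · simp
        omega
    obtain ⟨z, hz⟩ := exists_eq_append_append h1 h2.1 h2.2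
    rw [hz] at hc
    have hrot : z ++ ((s ++ B₁) ++ a :: (B₂ ++ p)) ~r a :: (B₂ ++ (p ++ (z ++ s) ++ B₁)) := by
      simpa using List.isRotated_append (l := z ++ (s ++ B₁)) (l' := a :: (B₂ ++ p))
    exact hins B hB B₁ B₂ a e ((hc _ hrot).of_infix (List.suffix_append _ _).isInfix)
  obtain ⟨n, hn, rfl⟩ := List.isRotated_iff_mod.1 hy.symm
  rw [List.rotate_eq_drop_append_take hn]
  have hsplit := (List.take_append_drop n L.flatten).symm
  generalize L.flatten.take n = x at hsplit
  generalize L.flatten.drop n = y at hsplit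
  rcases List.flatten_eq_append_iff.1 hsplit with ⟨as, bs, rfl, rfl, rfl⟩ |
    ⟨as, bs, c, cs, ds, rfl, rfl, rfl⟩
  · rw [← List.flatten_append]
    have hmem : ∀ C ∈ bs ++ as, C ∈ as ++ bs := fun C hC => by simpa [or_comm] using hC
    have hl : (bs ++ as).length = (as ++ bs).length := by simp [add_comm]
    generalize bs ++ as = M at hmem hl
    match M, hl with
    | [], hl => rw [← hl] at hK; simp at hK
    | [_], hl => rw [← hl] at hK; simp at hK
    | B :: C :: M, _ =>
      have := key B (hmem B (by simp)) [] B rfl (C :: M) (by simp)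
        (fun D hD => hmem D (List.mem_cons_of_mem B hD))
      simpa using this
  · have := key (bs ++ c :: cs) (by simp) bs (c :: cs) rfl (ds ++ as)
      (by rintro h; simp at h; simp [h.1, h.2] at hK)
      (fun D hD => by simp at hD ⊢; tauto)
    simpa using this

end Construction

/-- Test that inserting a letter at any of the `c` positions starting with `i` into the word of
length `n` encoded by `N` creates a square. -/
noncomputable def insertTest (n N i c : ℕ) : Bool :=
  allFrom (fun j => force (fun P => allFrom (fun a => force (fun M =>
      Bool.rec true false (linTest (Nat.add n 1) M))
        (Nat.add (Nat.mod N P) (Nat.mul P (Nat.add a (Nat.mul 4 (Nat.div N P)))))) 3 1)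
    (Nat.pow 4 j)) c i

theorem insertTest_sound {u v : List (Fin 3)} {i c : ℕ}
    (h : insertTest (u ++ v).length (enc (u ++ v)) i c = true) (hi : i ≤ u.length)
    (hc : u.length < i + c) (a : Fin 3) : ¬ SquareFree (u ++ a :: v) := by
  rw [insertTest, allFrom_iff] at h
  simp only [force_eq, allFrom_iff, boolRec_true_false_iff] at h
  have h' := h u.length hi hc (a.val + 1) (by omega) (by omega)
  have e : enc (u ++ v) % 4 ^ u.length + 4 ^ u.length * ((a.val + 1) +
      4 * (enc (u ++ v) / 4 ^ u.length)) = enc (u ++ a :: v) := by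
    rw [← enc_take, ← enc_drop, List.take_left, List.drop_left, enc_append, enc]
  have hl : (u ++ v).length + 1 = (u ++ a :: v).length := by simp; omega
  rw [← linTest_iff, ← e, ← hl]
  exact h'

/-- The word whose letters are the last `n` decimal digits of a number, followed by a given word. -/
def digitsAppend (n : ℕ) : ℕ → List (Fin 3) → List (Fin 3) :=
  Nat.rec (motive := fun _ => ℕ → List (Fin 3) → List (Fin 3)) (fun _ w => w)
    (fun _ ih N w => force (fun M => ih M (Fin.ofNat 3 (Nat.mod N 10) :: w)) (Nat.div N 10)) n

/-- The ternary word of length `n` whose letters are the decimal digits of `N`. -/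
def word (n N : ℕ) : List (Fin 3) := digitsAppend n N []

theorem length_word (n N : ℕ) : (word n N).length = n := by
  have h : ∀ n N w, (digitsAppend n N w).length = n + w.length := by
    intro n
    induction n with
    | zero => intro N w; simp [digitsAppend]
    | succ n ih =>
      intro N w
      change (digitsAppend n (N / 10) (Fin.ofNat 3 (N % 10) :: w)).length = _
      rw [ih, List.length_cons]
      omega
  exact h n N []

/-- The blocks by which the letters are replaced. -/
def block : Fin 3 → List (Fin 3) :=
  ![word 28 0102101201020120210201210212, word 28 0102101202102012021201210212,
    word 28 0102101210201021202101210212]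

/-- The common prefix of all blocks and fillers. -/
def pfx : List (Fin 3) := word 8 01021012

/-- The common suffix of all blocks and fillers. -/
def sfx : List (Fin 3) := word 8 01210212

/-- Lengths and digits of the fillers, one for each residue of the length modulo `28`. -/
def fillers : List (ℕ × ℕ) :=
  [(40, 0102101201021201210212021012021201210212),
    (43, 0102101201021201210201202101201021201210212),
    (45, 010210120102120121012010212021012021201210212),
    (50, 01021012010212012101202120102012101201021201210212),
    (52, 0102101201021201210120212010201202101201021201210212),
    (54, 010210120102120121012021201210201202101201021201210212),
    (55, 0102101201021201210120102120210201202101201021201210212),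
    (56, 01021012010212012101202120121020120212010201202101210212),
    (57, 010210120102120121012021201020120210120102120210201210212),
    (58, 0102101201021201210120212012102010212012102120210201210212),
    (59, 01021012010212012102012021012010201210120102120210201210212),
    (60, 010210120102120121012010212021012010201202101201021201210212),
    (61, 0102101201021201210201202101201021201210212021012021201210212),
    (62, 01021012010212012101202120121020120210121020102120210201210212),
    (63, 010210120102120121012010212021020120212010212021012021201210212),
    (64, 0102101201021201210201202101201020121012021201210201202101210212),
    (65, 01021012010212012101201021202101201020120210120102120210201210212),
    (66, 010210120102120121012010212021020120210120102012101201021201210212),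
    (67, 0102101201021201210120212010201210120102120121020102120210201210212),
    (69, 010210120102120121012021201020121012021201210201202101201021201210212),
    (70, 0102101201021201210120212010201202101201021201210212021012021201210212),
    (72, 010210120102120121012010212021020120210120102120121020102120210201210212),
    (74, 01021012010212012101202120102012101201021201210201021202101201021201210212),
    (75, 010210120102120121012010212021020120210120102120121020120210201021201210212),
    (76, 0102101201021201210120102120210120102012021012102012021201210201202101210212),
    (77, 01021012010212012101202120102012101202120121020120210121020102120210201210212),
    (79, 0102101201021201210120102120210120212010212021020120212010212021012021201210212),
    (81, 010210120102120121012010212021012021201021202102012021201210212021012021201210212)]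

/-- Lengths and digits of further extremal circular words. -/
def sporadic : List (ℕ × ℕ) :=
  [(4, 0102),
    (6, 010212),
    (8, 01021012),
    (13, 0102012021012),
    (15, 010201210120212),
    (16, 0102012102010212),
    (18, 010201202102010212),
    (20, 01020120210201021012),
    (21, 010210120210201210212),
    (22, 0102101201021201210212),
    (23, 01020120210121020120212),
    (24, 010201210120210201210212),
    (28, 0102012021012010201210120212),
    (30, 010201202101201021201210120212),
    (32, 01020120210120102120121020120212),
    (33, 010201202101201021201210212021012),
    (34, 0102012021012010210120210201021012),
    (35, 01020120210120102120210121020120212),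
    (36, 010201202101201020121021202101210212),
    (38, 01020120210121020102120210121020120212),
    (39, 010201202101201021012102120121020120212),
    (41, 01020120210120102012101201021201210120212),
    (42, 010201202102010210120102120121021201021012),
    (44, 01020120210201210212010210120102012102010212),
    (46, 0102012021020102101201021201210201202102010212),
    (47, 01020120210120102101202102012102120121020120212),
    (48, 010201202101201021012021020102120210121020120212),
    (49, 0102012021012010212012102012021012010201210120212),
    (51, 010201202101210201021012021020102120210121020120212),
    (53, 01020120210121020102101202102012102120210121020120212)]

theorem extremalTest_sporadic : ∀ x ∈ sporadic ++ fillers,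
    force (extremalTest x.1) (enc (word x.1 x.2)) = true := by
  decide +kernel

/-- The conditions on a single block. -/
abbrev GoodBlock (B : List (Fin 3)) : Prop :=
  pfx <+: B ∧ sfx <:+ B ∧ 28 ≤ B.length ∧ (∀ o < B.length, pfx <+: (B ++ pfx).drop o → o = 0) ∧
    force (fun N => insertTest (sfx ++ (B ++ pfx)).length N 8 (B.length + 1))
      (enc (sfx ++ (B ++ pfx))) = true

/-- The conditions on a pair of distinct blocks. -/
abbrev GoodPair (B C : List (Fin 3)) : Prop :=
  B.take 13 ≠ C.take 13 ∧ B.drop (B.length - 16) ≠ C.drop (C.length - 16) ∧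
    force (linTest (B ++ (C ++ pfx.dropLast)).length) (enc (B ++ (C ++ pfx.dropLast))) = true

theorem goodBlock_block : ∀ a, GoodBlock (block a) := by
  decide +kernel

theorem goodBlock_filler : ∀ x ∈ fillers, GoodBlock (word x.1 x.2) := by
  decide +kernel

theorem goodPair_block : ∀ a b, a ≠ b → GoodPair (block a) (block b) := by
  decide +kernel

theorem goodPair_filler : ∀ x ∈ fillers, ∀ a,
    GoodPair (block a) (word x.1 x.2) ∧ GoodPair (word x.1 x.2) (block a) := by
  decide +kernel

/-- The circular list of blocks of a word, closed by a filler. -/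
def blockList (u : List (Fin 3)) (x : ℕ × ℕ) : List (List (Fin 3)) :=
  u.map block ++ [word x.1 x.2]

theorem length_block (a : Fin 3) : (block a).length = 28 := by
  revert a
  simp [Fin.forall_fin_succ, block, length_word]

theorem length_flatten_blockList (u : List (Fin 3)) (x : ℕ × ℕ) :
    (blockList u x).flatten.length = 28 * u.length + x.1 := by
  have h : (List.map List.length (List.map block u)).sum = 28 * u.length := by
    induction u with
    | nil => rfl
    | cons a u ih => simp [length_block] at ih ⊢; omega
  simp only [blockList, List.flatten_append, List.length_append, List.length_flatten, h]
  simp [length_word]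

theorem mem_blockList {u : List (Fin 3)} {x : ℕ × ℕ} {B : List (Fin 3)} (h : B ∈ blockList u x) :
    (∃ a, B = block a) ∨ B = word x.1 x.2 := by
  simp only [blockList, List.mem_append, List.mem_map, List.mem_singleton] at h
  exact h.imp (fun ⟨a, _, ha⟩ => ⟨a, ha.symm⟩) id

theorem goodBlock_of_mem {u : List (Fin 3)} {x : ℕ × ℕ} (hx : x ∈ fillers) {B : List (Fin 3)}
    (h : B ∈ blockList u x) : GoodBlock B := by
  rcases mem_blockList h with ⟨a, rfl⟩ | rfl
  · exact goodBlock_block a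
  · exact goodBlock_filler x hx

theorem goodPair_of_mem {u : List (Fin 3)} {x : ℕ × ℕ} (hx : x ∈ fillers) {B C : List (Fin 3)}
    (hB : B ∈ blockList u x) (hC : C ∈ blockList u x) (hne : B ≠ C) : GoodPair B C := by
  rcases mem_blockList hB with ⟨a, rfl⟩ | rfl <;> rcases mem_blockList hC with ⟨b, rfl⟩ | rfl
  · exact goodPair_block a b fun h => hne (h ▸ rfl)
  · exact (goodPair_filler x hx a).1
  · exact (goodPair_filler x hx b).2
  · exact absurd rfl hne

theorem block_injective : Function.Injective block := fun a b h => by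
  by_contra hne
  exact (goodPair_block a b hne).1 (h ▸ rfl)

theorem SquareFree.map_of_injective {α β : Type*} {f : α → β} (hf : Function.Injective f)
    {u : List α} (hu : SquareFree u) : SquareFree (u.map f) := by
  rw [squareFree_iff] at hu ⊢
  intro q l hl hq
  obtain ⟨j, hj, hne⟩ := hu q l hl (by simpa using hq)
  exact ⟨j, hj, by simpa [(Option.map_injective hf).eq_iff] using hne⟩

theorem circSquareFree_flatten_blockList {u : List (Fin 3)} (hu : SquareFree u) (hu0 : u ≠ [])
    {x : ℕ × ℕ} (hx : x ∈ fillers) : CircSquareFree (blockList u x).flatten := by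
  have hcs : CircSquareFree (blockList u x) := by
    refine (hu.map_of_injective block_injective).circSquareFree_append fun h => ?_
    obtain ⟨a, -, ha⟩ := List.mem_map.1 h
    exact (goodPair_filler x hx a).1.1 (ha ▸ rfl)
  have hpos := List.length_pos_iff.2 hu0
  refine hcs.flatten (p := pfx) (dp := 13) (ds := 16) ?_ ?_ (by norm_num) (by norm_num)
    (fun B hB => (goodBlock_of_mem hx hB).1) (fun B hB => ?_) (fun B hB o ho => ?_)
    (fun B hB C hC h => ?_) (fun B hB C hC h => ?_) (fun B hB C hC hne => ?_)
  · simp [blockList]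
    omega
  · exact List.ne_nil_of_length_pos (by rw [pfx, length_word]; norm_num)
  · have := (goodBlock_of_mem hx hB).2.2.1
    omega
  · by_cases hlt : o < B.length
    · exact Or.inl ((goodBlock_of_mem hx hB).2.2.2.1 o hlt ho)
    · have := ho.length_le
      rw [List.length_drop, List.length_append] at this
      have h8 : pfx.length = 8 := length_word _ _
      omega
  · by_contra hne
    exact (goodPair_of_mem hx hB hC hne).1 h
  · by_contra hne
    exact (goodPair_of_mem hx hB hC hne).2.1 h
  · exact linTest_iff.1 (goodPair_of_mem hx hB hC hne).2.2

theorem extremal_flatten_blockList {u : List (Fin 3)} (hu : SquareFree u) (hu0 : u ≠ [])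
    {x : ℕ × ℕ} (hx : x ∈ fillers) : ExtremalCircSquareFree (blockList u x).flatten := by
  rw [extremalCircSquareFree_iff]
  refine ⟨circSquareFree_flatten_blockList hu hu0 hx, fun y hy a => ?_⟩
  have hpos := List.length_pos_iff.2 hu0
  have h8 : pfx.length = 8 := length_word _ _
  have h8' : sfx.length = 8 := length_word _ _
  refine not_circSquareFree_cons_of_blocks (p := pfx) (s := sfx) ?_
    (fun B hB => (goodBlock_of_mem hx hB).1) (fun B hB => (goodBlock_of_mem hx hB).2.1)
    (fun B hB => ?_) (fun B hB B₁ B₂ a e => ?_) hy a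
  · simp [blockList]
    omega
  · have := (goodBlock_of_mem hx hB).2.2.1
    omega
  · have h := (goodBlock_of_mem hx hB).2.2.2.2
    subst e
    rw [force_eq] at h
    rw [show sfx ++ (B₁ ++ B₂ ++ pfx) = (sfx ++ B₁) ++ (B₂ ++ pfx) by simp] at h
    refine insertTest_sound h ?_ ?_ a <;> simp <;> omega

theorem exists_squareFree_length (k : ℕ) : ∃ u : List (Fin 3), u.length = k ∧ SquareFree u := by
  induction k with
  | zero => exact ⟨[], rfl, fun x hx h => hx (by simpa using h)⟩
  | succ k ih =>
    obtain ⟨u, rfl, hu⟩ := ih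
    rcases eq_or_ne u [] with rfl | hu0
    · exact ⟨[0], rfl, linTest_iff.1 rfl⟩
    · obtain ⟨x, hx⟩ : ∃ x, x ∈ fillers := ⟨_, List.mem_cons_self⟩
      have h := (circSquareFree_flatten_blockList hu hu0 hx).squareFree
      have hl := length_flatten_blockList u x
      have hpos := List.length_pos_iff.2 hu0
      exact ⟨(blockList u x).flatten.take (u.length + 1), by rw [List.length_take]; omega,
        h.of_infix (List.take_prefix _ _).isInfix⟩

theorem exists_extremal_filler_add {x : ℕ × ℕ} (hx : x ∈ fillers) (k : ℕ) :
    ∃ w : List (Fin 3), w.length = 28 * k + x.1 ∧ ExtremalCircSquareFree w := by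
  rcases Nat.eq_zero_or_pos k with rfl | hk
  · refine ⟨word x.1 x.2, by simp [length_word], ?_⟩
    rw [← extremalTest_iff, length_word]
    exact extremalTest_sporadic x (List.mem_append_right _ hx)
  · obtain ⟨u, rfl, hu⟩ := exists_squareFree_length k
    exact ⟨(blockList u x).flatten, length_flatten_blockList u x,
      extremal_flatten_blockList hu (List.length_pos_iff.1 hk) hx⟩

theorem exists_extremal_sporadic {x : ℕ × ℕ} (hx : x ∈ sporadic) :
    ∃ w : List (Fin 3), w.length = x.1 ∧ ExtremalCircSquareFree w := by
  refine ⟨word x.1 x.2, length_word _ _, ?_⟩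
  rw [← extremalTest_iff, length_word]
  exact extremalTest_sporadic x (List.mem_append_left _ hx)

theorem sporadic_or_filler {n : ℕ} (hn : 38 ≤ n) :
    (∃ x ∈ sporadic, n = x.1) ∨ ∃ x ∈ fillers, ∃ k, n = 28 * k + x.1 := by
  have base : ∀ n < 82, 38 ≤ n →
      (∃ x ∈ sporadic, n = x.1) ∨ ∃ x ∈ fillers, ∃ k < 2, n = 28 * k + x.1 := by
    decide +kernel
  have res : ∀ r < 28, ∃ x ∈ fillers, x.1 < 82 ∧ x.1 % 28 = r := by
    decide +kernel
  by_cases h : n < 82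
  · exact (base n h hn).imp_right fun ⟨x, hx, k, _, hk⟩ => ⟨x, hx, k, hk⟩
  · obtain ⟨x, hx, hlt, hr⟩ := res (n % 28) (Nat.mod_lt _ (by norm_num))
    exact Or.inr ⟨x, hx, (n - x.1) / 28, by omega⟩

/-- Theorem 3: there is an extremal square-free ternary circular word of length `n` iff
`n ∈ ℬ = {4,6,8,13,15,16,18,20,21,22,23,24,28,30,32,33,34,35,36} ∪ {m : m ≥ 38}`. -/
theorem extremal_circular_squarefree_lengths (n : ℕ) :
    (∃ w : List (Fin 3), w.length = n ∧ ExtremalCircSquareFree w) ↔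
      n ∈ ({4, 6, 8, 13, 15, 16, 18, 20, 21, 22, 23, 24, 28, 30, 32, 33, 34, 35, 36} : Set ℕ)
        ∪ {m | 38 ≤ m} := by
  constructor
  · rintro ⟨w, rfl, hw⟩
    by_contra hn
    by_cases h5 : w.length ≤ 5
    · refine not_extremal_of_test_nil (noExtremalTest_nil w.length ?_) hw
      generalize w.length = n at *
      interval_cases n <;> simp at hn ⊢
    · have hlt : w.length < 38 := by
        by_contra h
        exact hn (Or.inr (by simpa using h))
      by_cases h37 : w.length = 37
      · exact not_extremal_of_test (by omega) (h37 ▸ noExtremalTest_thirtySeven) hw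
      · refine not_extremal_of_test (by omega) (noExtremalTest_eq_true w.length ?_) hw
        generalize w.length = n at *
        interval_cases n <;> simp at hn h5 h37 ⊢
  · rintro (hn | hn)
    · have small : ∀ m ∈ [4, 6, 8, 13, 15, 16, 18, 20, 21, 22, 23, 24, 28, 30, 32, 33, 34, 35, 36],
          ∃ x ∈ sporadic, m = x.1 := by decide +kernel
      obtain ⟨x, hx, rfl⟩ := small n (by simpa using hn)
      exact exists_extremal_sporadic hx
    · rcases sporadic_or_filler hn with ⟨x, hx, rfl⟩ | ⟨x, hx, k, rfl⟩
      · exact exists_extremal_sporadic hx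
      · exact exists_extremal_filler_add hx k
end

section
/- For every integer n ≥ 18, there exists a square-free circular word of length n over the alphabet {0, 1, 2}. -/
namespace TernaryCircular

/-! ### Periodic square-free sequences -/

/-- The `n`-periodic sequence `f` spells a square-free circular word of length `n`. -/
def PeriodicSquareFree (n : ℕ) (f : ℕ → Fin 3) : Prop :=
  (∀ i, f (i + n) = f i) ∧ ∀ i k, 0 < k → 2 * k ≤ n → ∃ j < k, f (i + j) ≠ f (i + k + j)

theorem PeriodicSquareFree.circSquareFree {n : ℕ} {f : ℕ → Fin 3} (hf : PeriodicSquareFree n f) :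
    CircSquareFree ((List.range n).map f) := by
  rintro u hu x hx ⟨s, t, hst⟩
  obtain ⟨r, rfl⟩ := hu.symm
  have hper : ∀ i, f (i % n) = f i := Function.Periodic.map_mod_nat hf.1
  have hlen : s.length + (x.length + x.length) + t.length = n := by
    simpa [Nat.add_assoc] using congrArg List.length hst
  have hget : ∀ i < n, (s ++ (x ++ x) ++ t)[i]? = some (f (i + r)) := by
    intro i hi
    rw [hst, List.getElem?_eq_getElem (by simpa using hi), List.getElem_rotate]
    simp [hper]
  have hxpos : 0 < x.length := List.length_pos_iff.mpr hx
  obtain ⟨j, hj, hne⟩ := hf.2 (s.length + r) x.length hxpos (by omega)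
  have h₁ := hget (s.length + j) (by omega)
  have h₂ := hget (s.length + x.length + j) (by omega)
  rw [List.append_assoc, List.getElem?_append_right (by omega), List.append_assoc,
    List.getElem?_append_left (by omega)] at h₁
  rw [List.append_assoc, List.getElem?_append_right (by omega), List.append_assoc,
    List.getElem?_append_right (by omega), List.getElem?_append_left (by omega)] at h₂
  rw [show s.length + j - s.length = j by omega] at h₁
  rw [show s.length + x.length + j - s.length - x.length = j by omega, h₁] at h₂
  apply hne
  rw [show s.length + r + j = s.length + j + r by omega,
    show s.length + r + x.length + j = s.length + x.length + j + r by omega]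
  exact Option.some.inj h₂

/-! ### Testing for squares with bit masks -/

/-- The number whose binary digits mark the positions of the letter `a`. -/
def mask (a : Fin 3) : List (Fin 3) → ℕ
  | [] => 0
  | b :: l => (if b = a then 1 else 0) + 2 * mask a l

/-- The binary expansion of `r` has no run of more than `k` ones. -/
def noRun : ℕ → ℕ → Bool
  | 0, r => Nat.beq r 0
  | k + 1, r => bif Nat.beq r 0 then true else noRun k (Nat.land r (Nat.shiftRight r 1))

/-- The word with letter masks `x`, `y`, `z` has no square of half-length at most `K`. -/
def noSquares (x y z : ℕ) : ℕ → Bool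
  | 0 => true
  | k + 1 => bif noSquares x y z k then
      noRun k (Nat.lor (Nat.lor (Nat.land x (Nat.shiftRight x (k + 1)))
        (Nat.land y (Nat.shiftRight y (k + 1)))) (Nat.land z (Nat.shiftRight z (k + 1))))
      else false

theorem testBit_mask (a : Fin 3) (l : List (Fin 3)) (i : ℕ) :
    (mask a l).testBit i = decide (l[i]? = some a) := by
  induction l generalizing i with
  | nil => simp [mask]
  | cons b l ih =>
    cases i with
    | zero => by_cases h : b = a <;> simp [mask, h, Nat.testBit_zero]
    | succ i =>
      have : (mask a (b :: l)) / 2 = mask a l := by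
        simp only [mask]; split_ifs <;> omega
      rw [Nat.testBit_succ, this, ih, List.getElem?_cons_succ]

theorem mask_append (a : Fin 3) (l l' : List (Fin 3)) :
    mask a (l ++ l') = mask a l + 2 ^ l.length * mask a l' := by
  induction l with
  | nil => simp [mask]
  | cons b l ih => simp only [List.cons_append, mask, ih, List.length_cons, pow_succ]; ring

theorem mask_drop (a : Fin 3) (l : List (Fin 3)) (k : ℕ) :
    mask a (l.drop k) = mask a l >>> k :=
  Nat.eq_of_testBit_eq fun i => by simp [testBit_mask]

theorem mask_take (a : Fin 3) (l : List (Fin 3)) (k : ℕ) :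
    mask a (l.take k) = mask a l % 2 ^ k :=
  Nat.eq_of_testBit_eq fun i => by
    by_cases h : i < k <;> simp [testBit_mask, h]

theorem beq_zero_eq_false {r i : ℕ} (h : r.testBit i = true) : Nat.beq r 0 = false := by
  rw [Bool.eq_false_iff]
  intro h0
  rw [Nat.eq_of_beq_eq_true h0, Nat.zero_testBit] at h
  exact Bool.false_ne_true h

theorem noRun_eq_false {k r i : ℕ} (h : ∀ j ≤ k, r.testBit (i + j) = true) :
    noRun k r = false := by
  induction k generalizing r with
  | zero => exact beq_zero_eq_false (h 0 le_rfl)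
  | succ k ih =>
    have hand : ∀ j ≤ k, (Nat.land r (Nat.shiftRight r 1)).testBit (i + j) = true := by
      intro j hj
      change (r &&& r >>> 1).testBit (i + j) = true
      rw [Nat.testBit_and, Nat.testBit_shiftRight, h j (by omega),
        show 1 + (i + j) = i + (j + 1) by omega, h (j + 1) (by omega)]
      rfl
    rw [noRun, beq_zero_eq_false (h 0 (Nat.zero_le _))]
    exact ih hand

theorem exists_ne_of_noSquares {l : List (Fin 3)} {K : ℕ}
    (h : noSquares (mask 0 l) (mask 1 l) (mask 2 l) K = true) {i k : ℕ} (hk : 0 < k)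
    (hkK : k ≤ K) (hl : i + 2 * k ≤ l.length) : ∃ j < k, l[i + j]? ≠ l[i + k + j]? := by
  induction K with
  | zero => omega
  | succ K ih =>
    rw [noSquares, Bool.cond_false_right, Bool.and_eq_true] at h
    rcases Nat.lt_or_ge K k with hlt | hge
    · obtain rfl : k = K + 1 := by omega
      by_contra! hcon
      rw [noRun_eq_false (i := i)] at h
      · simp at h
      intro j hj
      change ((mask 0 l &&& mask 0 l >>> (K + 1)) ||| (mask 1 l &&& mask 1 l >>> (K + 1)) |||
        (mask 2 l &&& mask 2 l >>> (K + 1))).testBit (i + j) = true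
      simp only [Nat.testBit_or, Nat.testBit_and, Nat.testBit_shiftRight, testBit_mask,
        show K + 1 + (i + j) = i + (K + 1) + j by omega, ← hcon j (by omega),
        List.getElem?_eq_getElem (show i + j < l.length by omega)]
      generalize l[i + j] = a
      revert a
      decide
    · exact ih h.1 hge

/-! ### Short circular words -/

/-- Iterates of the morphism `0 ↦ 1`, `1 ↦ 20`, `2 ↦ 210` at the letter `2`; they are prefixes of
the ternary Thue–Morse word. -/
def ternaryThueMorse : ℕ → List (Fin 3)
  | 0 => [2]
  | k + 1 => (ternaryThueMorse k).flatMap ![[1], [2, 0], [2, 1, 0]]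

/-- Words closing up a factor of the ternary Thue–Morse word to a square-free circular word, paired
with the position at which that factor starts. -/
def closings : List (ℕ × List (Fin 3)) :=
  [(38, [0, 2, 1, 2]), (13, [0, 2, 1, 2, 0]), (27, [2, 0, 1, 0, 2, 1, 0, 1, 2, 0, 2, 1]),
   (33, [2, 0, 1, 0, 2, 1, 0, 1, 2, 1, 0, 2]), (17, [2, 0, 1, 0, 2]),
   (17, [1, 2, 0, 1, 0, 2, 1, 0, 1, 2, 1, 0, 2]), (24, [1, 0, 2, 1, 2, 0, 1, 0, 2, 0, 1, 2, 0]),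
   (17, [1, 2, 0, 1, 0, 2, 0, 1, 2, 1, 0, 2]), (12, [0, 1, 0, 2, 1, 2, 0, 1])]

/-- The word of length `n` obtained from a factor of the ternary Thue–Morse word by appending a
closing word. -/
def closedWord (n : ℕ) (s : ℕ × List (Fin 3)) : List (Fin 3) :=
  ((ternaryThueMorse 9).drop s.1).take (n - s.2.length) ++ s.2

/-- The mask of `closedWord n s ++ closedWord n s`. -/
def doubledMask (a : Fin 3) (n : ℕ) (s : ℕ × List (Fin 3)) : ℕ :=
  ((mask a (ternaryThueMorse 9) >>> s.1) % 2 ^ (n - s.2.length) +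
    2 ^ (n - s.2.length) * mask a s.2) * (2 ^ n + 1)

theorem length_closedWord {n : ℕ} (hn : 18 ≤ n) (hn' : n < 306) {s : ℕ × List (Fin 3)}
    (hs : s ∈ closings) : (closedWord n s).length = n := by
  have hs' : s.1 ≤ 38 ∧ s.2.length ≤ 18 := by
    revert s
    decide
  have hlen : 344 ≤ (ternaryThueMorse 9).length := by decide +kernel
  simp only [closedWord, List.length_append, List.length_take, List.length_drop]
  omega

theorem mask_closedWord_append_self {n : ℕ} (hn : 18 ≤ n) (hn' : n < 306)
    {s : ℕ × List (Fin 3)} (hs : s ∈ closings) (a : Fin 3) :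
    mask a (closedWord n s ++ closedWord n s) = doubledMask a n s := by
  have hlen := length_closedWord hn hn' hs
  have htake : (((ternaryThueMorse 9).drop s.1).take (n - s.2.length)).length =
      n - s.2.length := by
    have := hlen
    simp only [closedWord, List.length_append] at this
    omega
  rw [mask_append, hlen, closedWord, mask_append, htake, mask_take, mask_drop, doubledMask]
  ring

theorem exists_closing : ∀ n < 306, 18 ≤ n → ∃ s ∈ closings,
    noSquares (doubledMask 0 n s) (doubledMask 1 n s) (doubledMask 2 n s) (n / 2) = true := by
  decide +kernel

theorem exists_periodicSquareFree_of_lt {n : ℕ} (hn : 18 ≤ n) (hn' : n < 306) :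
    ∃ f, PeriodicSquareFree n f := by
  obtain ⟨s, hs, hsq⟩ := exists_closing n hn' hn
  have hlen := length_closedWord hn hn' hs
  simp only [← mask_closedWord_append_self hn hn' hs] at hsq
  set w := closedWord n s
  refine ⟨fun i => w.getD (i % n) 0, fun i => by simp, fun i k hk hkn => ?_⟩
  have hget : ∀ i < 2 * n, (w ++ w)[i]? = some (w.getD (i % n) 0) := by
    intro i hi
    rcases Nat.lt_or_ge i n with h | h
    · rw [List.getElem?_append_left (by omega), Nat.mod_eq_of_lt h,
        List.getD_eq_getElem _ _ (by omega), List.getElem?_eq_getElem]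
    · rw [List.getElem?_append_right (by omega), hlen, Nat.mod_eq_sub_mod h,
        Nat.mod_eq_of_lt (by omega), List.getD_eq_getElem _ _ (by omega),
        List.getElem?_eq_getElem]
  have hi : i % n < n := Nat.mod_lt _ (by omega)
  obtain ⟨j, hj, hne⟩ := exists_ne_of_noSquares hsq (i := i % n) hk (by omega)
    (by rw [List.length_append]; omega)
  refine ⟨j, hj, fun heq => hne ?_⟩
  rw [hget _ (by omega), hget _ (by omega)]
  simpa [Nat.add_assoc] using heq

/-! ### The substitution -/

/-- The two images of the letter `a`, of lengths `17` and `18`. -/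
def block (a : Fin 3) (c : Bool) : List (Fin 3) :=
  (bif c then [0, 1, 2, 0, 2, 1, 0, 2, 0, 1, 0, 2, 1, 2, 0, 2, 1, 0]
    else [0, 1, 2, 0, 2, 1, 2, 0, 1, 0, 2, 1, 2, 0, 2, 1, 0]).map (· + a)

theorem length_block (a : Fin 3) (c : Bool) : (block a c).length = 17 + c.toNat := by
  cases c <;> simp [block]

theorem getElem?_block_last : ∀ (a : Fin 3) (c : Bool),
    (block a c)[(block a c).length - 1]? = some a := by
  decide

theorem noSquares_blocks : ∀ a₀ a₁ a₂ a₃ : Fin 3, a₀ ≠ a₁ → a₁ ≠ a₂ → a₂ ≠ a₃ →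
    ¬ (a₀ = a₂ ∧ a₁ = a₃) → ∀ c₀ c₁ c₂ c₃ : Bool,
      noSquares (mask 0 (block a₀ c₀ ++ (block a₁ c₁ ++ (block a₂ c₂ ++ block a₃ c₃))))
        (mask 1 (block a₀ c₀ ++ (block a₁ c₁ ++ (block a₂ c₂ ++ block a₃ c₃))))
        (mask 2 (block a₀ c₀ ++ (block a₁ c₁ ++ (block a₂ c₂ ++ block a₃ c₃)))) 24 = true := by
  decide +kernel

/-- The prefix of length `8` of a block occurs in a product of two blocks only at the start of a
block, and it determines the letter. -/
theorem block_prefix_sync : ∀ a b d : Fin 3, a ≠ b → ∀ c c' c'' : Bool,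
    ∀ t < (block a c).length, ((block a c ++ block b c').drop t).take 8 = (block d c'').take 8 →
      t = 0 ∧ a = d := by
  decide +kernel

/-- `g` is the product of the blocks `block (a p) (c p)`, the `p`-th one starting at `S p`. -/
structure IsImage (a : ℕ → Fin 3) (c : ℕ → Bool) (S : ℕ → ℕ) (g : ℕ → Fin 3) : Prop where
  zero : S 0 = 0
  succ : ∀ p, S (p + 1) = S p + (17 + (c p).toNat)
  getElem? : ∀ p j, j < 17 + (c p).toNat → (block (a p) (c p))[j]? = some (g (S p + j))

namespace IsImage

variable {a : ℕ → Fin 3} {c : ℕ → Bool} {S : ℕ → ℕ} {g : ℕ → Fin 3}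

theorem succ_bounds (h : IsImage a c S g) (p : ℕ) :
    S p + 17 ≤ S (p + 1) ∧ S (p + 1) ≤ S p + 18 := by
  have := h.succ p
  have := (c p).toNat_le
  omega

theorem strictMono (h : IsImage a c S g) : StrictMono S :=
  strictMono_nat_of_lt_succ fun p => by have := h.succ_bounds p; omega

theorem exists_mem_block (h : IsImage a c S g) (t : ℕ) : ∃ p, S p ≤ t ∧ t < S (p + 1) := by
  induction t with
  | zero => exact ⟨0, by simp [h.zero], by have := h.succ_bounds 0; omega⟩
  | succ t ih =>
    obtain ⟨p, h₁, h₂⟩ := ih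
    rcases Nat.lt_or_ge (t + 1) (S (p + 1)) with hlt | hge
    · exact ⟨p, by omega, hlt⟩
    · exact ⟨p + 1, hge, by have := h.succ_bounds (p + 1); omega⟩

theorem apply_last (h : IsImage a c S g) (p : ℕ) : g (S (p + 1) - 1) = a p := by
  have h₁ := getElem?_block_last (a p) (c p)
  rw [length_block, h.getElem? p _ (by omega)] at h₁
  rw [h.succ, ← Option.some.inj h₁]
  congr 1
  omega

/-- Prepending a block to a word read off from `g`. -/
theorem getElem?_block_append (h : IsImage a c S g) {l : List (Fin 3)} {p : ℕ}
    (hl : ∀ j < l.length, l[j]? = some (g (S (p + 1) + j))) :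
    ∀ j < (block (a p) (c p) ++ l).length,
      (block (a p) (c p) ++ l)[j]? = some (g (S p + j)) := by
  intro j hj
  rw [List.length_append, length_block] at hj
  rcases Nat.lt_or_ge j (17 + (c p).toNat) with hlt | hge
  · rw [List.getElem?_append_left (by rwa [length_block]), h.getElem? p j hlt]
  · rw [List.getElem?_append_right (by rwa [length_block]), length_block, hl _ (by omega), h.succ]
    congr 2
    omega

theorem getElem?_block_self (h : IsImage a c S g) (p : ℕ) :
    ∀ j < (block (a p) (c p)).length, (block (a p) (c p))[j]? = some (g (S p + j)) :=
  fun j hj => h.getElem? p j (by rwa [length_block] at hj)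

/-- An occurrence in `g` of the prefix of length `8` of the `p`-th block starts a block with the
same letter. -/
theorem sync (h : IsImage a c S g) (hne : ∀ p, a p ≠ a (p + 1)) {p t : ℕ}
    (ht : ∀ j < 8, g (S p + j) = g (t + j)) : ∃ q, S q = t ∧ a q = a p := by
  obtain ⟨q, h₁, h₂⟩ := h.exists_mem_block t
  have hq := h.succ q
  have hw := h.getElem?_block_append (h.getElem?_block_self (q + 1))
  obtain ⟨h₀, hq'⟩ := block_prefix_sync (a q) (a (q + 1)) (a p) (hne q) (c q) (c (q + 1)) (c p)
    (t - S q) (by rw [length_block]; omega) (by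
      refine List.ext_getElem? fun j => ?_
      rw [List.getElem?_take, List.getElem?_take]
      split_ifs with hj
      · rw [List.getElem?_drop, hw _ (by simp only [List.length_append, length_block]; omega),
          h.getElem? p j (by omega), ht j hj]
        congr 2
        omega
      · rfl)
  exact ⟨q, by omega, hq'⟩

theorem exists_ne_of_short (h : IsImage a c S g) (hne : ∀ p, a p ≠ a (p + 1))
    (hne' : ∀ p, ¬ (a p = a (p + 2) ∧ a (p + 1) = a (p + 3))) (i : ℕ) {k : ℕ} (hk : 0 < k)
    (hk' : k ≤ 24) : ∃ j < k, g (i + j) ≠ g (i + k + j) := by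
  obtain ⟨p, h₁, h₂⟩ := h.exists_mem_block i
  have hp := h.succ_bounds p
  have hw := h.getElem?_block_append (h.getElem?_block_append (h.getElem?_block_append
    (h.getElem?_block_self (p + 1 + 1 + 1))))
  have hlen : 68 ≤ (block (a p) (c p) ++ (block (a (p + 1)) (c (p + 1)) ++
      (block (a (p + 1 + 1)) (c (p + 1 + 1)) ++
        block (a (p + 1 + 1 + 1)) (c (p + 1 + 1 + 1))))).length := by
    simp only [List.length_append, length_block]
    omega
  obtain ⟨j, hj, hj'⟩ := exists_ne_of_noSquares (i := i - S p)
    (noSquares_blocks (a p) (a (p + 1)) (a (p + 1 + 1)) (a (p + 1 + 1 + 1)) (hne _) (hne _) (hne _)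
      (hne' p) (c p) (c (p + 1)) (c (p + 1 + 1)) (c (p + 1 + 1 + 1))) hk hk' (by omega)
  refine ⟨j, hj, fun heq => hj' ?_⟩
  rw [hw _ (by omega), hw _ (by omega), show S p + (i - S p + j) = i + j by omega,
    show S p + (i - S p + k + j) = i + k + j by omega, heq]

/-- A square of half-length `k` in `g` maps the block starts in its first half, up to a margin,
to those in its second half. -/
theorem exists_start_add (h : IsImage a c S g) (hne : ∀ p, a p ≠ a (p + 1)) {i k : ℕ}
    (hsq : ∀ j < k, g (i + j) = g (i + k + j)) {p q : ℕ} (hp : i ≤ S (p + 1))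
    (hp' : S p < i) (hq : i + k ≤ S (q + 1)) (hq' : S q < i + k) (r : ℕ)
    (hr : S (p + 1 + r) + 8 ≤ i + k) :
    S (q + 1 + r) = S (p + 1 + r) + k ∧ a (q + 1 + r) = a (p + 1 + r) := by
  have fwd : ∀ x, i ≤ S x → S x + 8 ≤ i + k → ∃ y, S y = S x + k ∧ a y = a x := by
    intro x h₁ h₂
    refine h.sync hne fun j hj => ?_
    have := hsq (S x - i + j) (by omega)
    rwa [show i + (S x - i + j) = S x + j by omega,
      show i + k + (S x - i + j) = S x + k + j by omega] at this
  have bwd : ∀ y, i + k ≤ S y → S y + 8 ≤ i + 2 * k → ∃ x, S x + k = S y := by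
    intro y h₁ h₂
    obtain ⟨x, hx, -⟩ := h.sync hne (p := y) (t := S y - k) fun j hj => by
      have := hsq (S y - k - i + j) (by omega)
      rw [show i + (S y - k - i + j) = S y - k + j by omega,
        show i + k + (S y - k - i + j) = S y + j by omega] at this
      exact this.symm
    exact ⟨x, by omega⟩
  have hmono := h.strictMono
  have step : ∀ x y, i ≤ S (x + 1) → S (x + 1) + 8 ≤ i + k → i + k ≤ S (y + 1) →
      S y < S (x + 1) + k → S x + k < S (y + 1) →
      S (y + 1) = S (x + 1) + k ∧ a (y + 1) = a (x + 1) := by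
    intro x y h₁ h₂ h₃ h₄ h₅
    obtain ⟨z, hz, hza⟩ := fwd _ h₁ h₂
    have hyz : y + 1 ≤ z := hmono.lt_iff_lt.mp (by omega)
    have hyz' := hmono.monotone hyz
    obtain ⟨z', hz'⟩ := bwd (y + 1) h₃ (by omega)
    have hxz : x + 1 ≤ z' := hmono.lt_iff_lt.mp (show S x < S z' by omega)
    have hxz' := hmono.monotone hxz
    obtain rfl : z = y + 1 := hmono.injective (by omega)
    exact ⟨hz, hza⟩
  induction r with
  | zero => exact step p q hp hr hq (by simp only [add_zero] at hr; omega) (by omega)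
  | succ r ih =>
    have h₁ := h.succ_bounds (p + 1 + r)
    have h₂ := h.succ_bounds (q + 1 + r)
    have h₃ : S (p + 1) ≤ S (p + 1 + r) := hmono.monotone (by omega)
    rw [← Nat.add_assoc] at hr
    obtain ⟨h₄, -⟩ := ih (by omega)
    exact step (p + 1 + r) (q + 1 + r) (by omega) hr (by omega) (by omega) (by omega)

theorem periodicSquareFree {m n : ℕ} (h : IsImage a c S g) (ha : PeriodicSquareFree m a)
    (hm : 4 ≤ m) (hS : ∀ p, S (p + m) = S p + n) (hg : ∀ t, g (t + n) = g t) :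
    PeriodicSquareFree n g := by
  have hne : ∀ p, a p ≠ a (p + 1) := fun p => by
    obtain ⟨j, hj, hj'⟩ := ha.2 p 1 one_pos (by omega)
    obtain rfl : j = 0 := by omega
    exact hj'
  have hne' : ∀ p, ¬ (a p = a (p + 2) ∧ a (p + 1) = a (p + 3)) := fun p ⟨h₁, h₂⟩ => by
    obtain ⟨j, hj, hj'⟩ := ha.2 p 2 two_pos (by omega)
    interval_cases j
    · exact hj' h₁
    · exact hj' h₂
  have hmono := h.strictMono
  refine ⟨hg, fun i' k hk hkn => ?_⟩
  rcases Nat.lt_or_ge k 25 with hk' | hk'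
  · exact h.exists_ne_of_short hne hne' i' hk (by omega)
  by_contra! hcon
  obtain ⟨i, hi, hsq⟩ : ∃ i, 0 < i ∧ ∀ j < k, g (i + j) = g (i + k + j) := by
    refine ⟨i' + n, by omega, fun j hj => ?_⟩
    rw [show i' + n + j = i' + j + n by omega, show i' + n + k + j = i' + k + j + n by omega,
      hg, hg, hcon j hj]
  have hstart : ∀ t, 0 < t → ∃ p, S p < t ∧ t ≤ S (p + 1) := fun t ht => by
    obtain ⟨p, h₁, h₂⟩ := h.exists_mem_block (t - 1)
    exact ⟨p, by omega, by omega⟩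
  obtain ⟨p, hp', hp⟩ := hstart i hi
  obtain ⟨q, hq', hq⟩ := hstart (i + k) (by omega)
  have hp₁ := h.succ_bounds p
  obtain ⟨s, hs, hs'⟩ := hstart (i + k - 7) (by omega)
  have hps : p + 1 ≤ s := by
    have : p + 1 < s + 1 := hmono.lt_iff_lt.mp (by omega)
    omega
  obtain ⟨r, rfl⟩ := Nat.exists_eq_add_of_le hps
  have key := h.exists_start_add hne hsq hp hp' hq hq'
  have keyr := key r (by omega)
  have hle : ∀ j ≤ r, a (p + 1 + j) = a (q + 1 + j) := fun j hj =>
    (key j (by have := hmono.monotone (show p + 1 + j ≤ p + 1 + r by omega); omega)).2.symm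
  have hlt : q + 1 + r < p + 1 + m :=
    hmono.lt_iff_lt.mp (by rw [hS]; omega)
  rcases Nat.lt_or_ge (S (p + 1 + r + 1)) (i + k) with hB | hA
  · have hr₁ := h.succ_bounds (p + 1 + r + 1)
    obtain rfl : q = p + 1 + r + 1 := by
      have h₁ : p + 1 + r + 1 < q + 1 := hmono.lt_iff_lt.mp (by omega)
      have h₂ : q < p + 1 + r + 1 + 1 := hmono.lt_iff_lt.mp (by omega)
      omega
    have hlast : a p = a (p + 1 + r + 1) := by
      have hq₀ := (key 0 (by
        have := hmono.monotone (show p + 1 + 0 ≤ p + 1 + r by omega); omega)).1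
      simp only [add_zero] at hq₀
      rw [← h.apply_last, ← h.apply_last, hq₀]
      have := hsq (S (p + 1) - 1 - i) (by omega)
      rwa [show i + (S (p + 1) - 1 - i) = S (p + 1) - 1 by omega,
        show i + k + (S (p + 1) - 1 - i) = S (p + 1) + k - 1 by omega] at this
    have hmr : 2 * (r + 2) ≤ m := by
      by_contra hmr
      have hm' : p + 1 + r + 1 + 1 + r = p + m := by omega
      have h₁ := hle r le_rfl
      rw [hm', ha.1, hlast] at h₁
      exact hne _ h₁
    obtain ⟨j, hj, hj'⟩ := ha.2 p (r + 2) (by omega) hmr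
    cases j with
    | zero => exact hj' (by rw [add_zero, hlast]; congr 1; omega)
    | succ j =>
      have := hle j (by omega)
      apply hj'
      rw [show p + (j + 1) = p + 1 + j by omega, this]
      congr 1
      omega
  · obtain rfl : q = p + 1 + r := by
      have h₁ : q < p + 1 + r + 1 := hmono.lt_iff_lt.mp (by omega)
      have h₂ : p + 1 + r < q + 1 := hmono.lt_iff_lt.mp (by omega)
      omega
    obtain ⟨j, hj, hj'⟩ := ha.2 (p + 1) (r + 1) (by omega) (by omega)
    apply hj'
    rw [hle j (by omega)]
    congr 1

end IsImage

theorem exists_isImage (a : ℕ → Fin 3) (c : ℕ → Bool) : ∃ S g, IsImage a c S g := by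
  let S : ℕ → ℕ := fun p => ∑ i ∈ Finset.range p, (17 + (c i).toNat)
  have hsucc : ∀ p, S (p + 1) = S p + (17 + (c p).toNat) := fun p => Finset.sum_range_succ _ _
  have hmono : StrictMono S := strictMono_nat_of_lt_succ fun p => by have := hsucc p; omega
  refine ⟨S, fun t => (block (a (Nat.findGreatest (S · ≤ t) t))
    (c (Nat.findGreatest (S · ≤ t) t))).getD (t - S (Nat.findGreatest (S · ≤ t) t)) 0,
    rfl, hsucc, fun p j hj => ?_⟩
  have hp : Nat.findGreatest (S · ≤ S p + j) (S p + j) = p := by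
    rw [Nat.findGreatest_eq_iff]
    refine ⟨(hmono.le_apply).trans (Nat.le_add_right _ _), fun _ => Nat.le_add_right _ _,
      fun x hx _ => ?_⟩
    have := hmono.monotone (Nat.succ_le_of_lt hx)
    have := hsucc p
    simp only [Nat.succ_eq_add_one] at *
    omega
  simp only [hp, Nat.add_sub_cancel_left]
  rw [← length_block (a p) (c p)] at hj
  rw [List.getD_eq_getElem _ _ hj, List.getElem?_eq_getElem hj]

theorem PeriodicSquareFree.exists_image {m n : ℕ} {a : ℕ → Fin 3} (ha : PeriodicSquareFree m a)
    (hm : 4 ≤ m) (hn : 17 * m ≤ n) (hn' : n ≤ 18 * m) : ∃ g, PeriodicSquareFree n g := by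
  let c : ℕ → Bool := fun p => decide (p % m < n - 17 * m)
  have hc : ∀ p, c (p + m) = c p := fun p => by simp [c]
  obtain ⟨S, g, h⟩ := exists_isImage a c
  have hSm : ∀ p ≤ m, S p = 17 * p + min p (n - 17 * m) := by
    intro p hp
    induction p with
    | zero => simp [h.zero]
    | succ p ih =>
      rw [h.succ, ih (by omega)]
      simp only [c, Nat.mod_eq_of_lt (show p < m by omega)]
      by_cases hlt : p < n - 17 * m <;> simp only [hlt, decide_true, decide_false,
        Bool.toNat_true, Bool.toNat_false] <;> omega
  have hS : ∀ p, S (p + m) = S p + n := by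
    intro p
    induction p with
    | zero => rw [zero_add, h.zero, hSm m le_rfl]; omega
    | succ p ih => rw [show p + 1 + m = p + m + 1 by omega, h.succ, h.succ, hc, ih]; omega
  refine ⟨g, h.periodicSquareFree ha hm hS fun t => ?_⟩
  obtain ⟨p, h₁, h₂⟩ := h.exists_mem_block t
  rw [h.succ] at h₂
  have e₁ := h.getElem? p (t - S p) (by omega)
  have e₂ := h.getElem? (p + m) (t - S p) (by rw [hc]; omega)
  rw [hc, ha.1, e₁, hS, show S p + (t - S p) = t by omega,
    show S p + n + (t - S p) = t + n by omega] at e₂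
  exact (Option.some.inj e₂).symm

theorem exists_periodicSquareFree (n : ℕ) (hn : 18 ≤ n) : ∃ f, PeriodicSquareFree n f := by
  induction n using Nat.strong_induction_on with
  | _ n ih =>
    rcases Nat.lt_or_ge n 306 with h | h
    · exact exists_periodicSquareFree_of_lt hn h
    · obtain ⟨a, ha⟩ := ih (n / 17) (by omega) (by omega)
      exact ha.exists_image (by omega) (by omega) (by omega)

end TernaryCircular

/-- Theorem 2 (Currie): for every `n ≥ 18` there is a square-free ternary circular word
of length `n`. -/
theorem currie_circular (n : ℕ) (hn : 18 ≤ n) :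
    ∃ w : List (Fin 3), w.length = n ∧ CircSquareFree w := by
  obtain ⟨f, hf⟩ := TernaryCircular.exists_periodicSquareFree n hn
  exact ⟨(List.range n).map f, by simp, hf.circSquareFree⟩
end

section
/- Let p and q be relatively prime positive integers, exactly one of which is even. For every integer n ≥ pq + (p−1)(q−1), there exist nonnegative integers a and b such that n = a p + b q and the sum a + b is even. -/
/-- Corollary 5: if `p, q` are relatively prime positive integers, exactly one of which is
even, then every `n ≥ pq + (p-1)(q-1)` can be written as `n = ap + bq` with `a + b` even. -/
theorem even_postage (p q : ℕ) (hp : 0 < p) (hq : 0 < q) (hpq : Nat.Coprime p q)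
    (hparity : Xor' (Even p) (Even q)) (n : ℕ) (hn : p * q + (p - 1) * (q - 1) ≤ n) :
    ∃ a b : ℕ, n = a * p + b * q ∧ Even (a + b) := by
  obtain ⟨m, rfl⟩ := Nat.exists_eq_add_of_le (Nat.le_of_add_right_le hn)
  obtain ⟨a, b, rfl⟩ := Nat.exists_add_mul_eq_of_gcd_dvd_of_mul_pred_le p q m
    (by simp [hpq.gcd_eq_one]) (by simpa using hn)
  have hab : Even (a + q + b) ∨ Even (a + (b + p)) := by
    simp only [Nat.even_add]
    rcases hparity with h | h <;> tauto
  rcases hab with h | h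
  · exact ⟨a + q, b, by ring, h⟩
  · exact ⟨a, b + p, by ring, h⟩
end
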